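/- arXiv:2004.00447 — 2 statements merged into one kernel-verified Lean document; each statement's English description precedes it below -/
import Mathlib

section
/- Let p ≥ 1 and let e ∈ I_{p,p+1} = Mat_{p,p+1}(F) ⊕ Mat_{p+1,p}(F) be nilpotent (as an element of gl_{2p+1}(F)). Extend e to a graded sl₂-triple {h, e, f}. If tr(2·Id − ad(h)) restricted to the f-annihilated subspace I_{p,p+1}^f equals 2p(p+1), then the underlying graded sl₂-module V = F^p ⊕ F^{p+1} is irreducible, e is regular nilpotent (i.e., e^{2p} ≠ 0), and eᵀ (the transpose, i.e., (x,y) ↦ (yᵀ, xᵀ)) lies in the H_{p,p+1}-orbit of e. -/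
open Matrix

/-- The space `I_{p,q}` of block-antidiagonal matrices in `gl_{p+q}(F)`
(for the partition `(p, q)`), as a submodule of the matrix space. -/
def antiDiagBlock (F : Type*) [Field F] (p q : ℕ) :
    Submodule F (Matrix (Fin p ⊕ Fin q) (Fin p ⊕ Fin q) F) where
  carrier := {m | (∀ i j, m (Sum.inl i) (Sum.inl j) = 0) ∧
    ∀ i j, m (Sum.inr i) (Sum.inr j) = 0}
  add_mem' := by
    rintro a b ⟨ha1, ha2⟩ ⟨hb1, hb2⟩
    exact ⟨fun i j => by simp [Matrix.add_apply, ha1 i j, hb1 i j],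
           fun i j => by simp [Matrix.add_apply, ha2 i j, hb2 i j]⟩
  zero_mem' := ⟨fun i j => rfl, fun i j => rfl⟩
  smul_mem' := by
    rintro c a ⟨ha1, ha2⟩
    exact ⟨fun i j => by simp [Matrix.smul_apply, ha1 i j],
           fun i j => by simp [Matrix.smul_apply, ha2 i j]⟩

/-- The adjoint action `ad(A) = [A, ·]` on the matrix space. -/
def matAd (F : Type*) [Field F] {n : Type*} [Fintype n] [DecidableEq n]
    (A : Matrix n n F) : Module.End F (Matrix n n F) :=
  LinearMap.mulLeft F A - LinearMap.mulRight F A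

namespace Sl2Aux

section General
variable {F : Type*} [Field F] {M : Type*} [AddCommGroup M] [Module F M]

structure Trip (E H G : Module.End F M) : Prop where
  he : ∀ v, H (E v) = E (H v) + (2:F) • E v
  hg : ∀ v, H (G v) = G (H v) - (2:F) • G v
  eg : ∀ v, E (G v) = G (E v) + H v
  nE : ∃ N : ℕ, ∀ v, (E ^ N) v = 0
  nG : ∃ N : ℕ, ∀ v, (G ^ N) v = 0

variable {E H G : Module.End F M}

theorem Trip.symm (t : Trip E H G) : Trip G (-H) E where
  he v := by simp [t.hg]; abel
  hg v := by simp [t.he]; abel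
  eg v := by simp [t.eg]
  nE := t.nG
  nG := t.nE

theorem Trip.wE (t : Trip E H G) {μ : F} {v : M} (hv : H v = μ • v) (k : ℕ) :
    H ((E ^ k) v) = (μ + 2 * k) • (E ^ k) v := by
  induction k with
  | zero => simp [hv]
  | succ k ih =>
    rw [pow_succ', Module.End.mul_apply, t.he, ih, map_smul, ← add_smul]
    congr 1; push_cast; ring

theorem Trip.wG (t : Trip E H G) {μ : F} {v : M} (hv : H v = μ • v) (k : ℕ) :
    H ((G ^ k) v) = (μ - 2 * k) • (G ^ k) v := by
  have := t.symm.wE (μ := -μ) (v := v) (by simp [hv]) k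
  rw [LinearMap.neg_apply, neg_eq_iff_eq_neg, ← neg_smul] at this
  rw [this]; congr 1; ring

/-- commutation of `E` with powers of `G` on `ker E`. -/
theorem Trip.eGpow (t : Trip E H G) {u : M} (hu : E u = 0) (k : ℕ) :
    E ((G ^ (k+1)) u) = ((k:F)+1) • (G ^ k) (H u - (k:F) • u) := by
  have hG : ∀ k : ℕ, H ((G ^ k) u) = (G ^ k) (H u) - (2 * k : F) • (G ^ k) u := by
    intro k
    induction k with
    | zero => simp
    | succ k ih =>
      rw [pow_succ', Module.End.mul_apply, t.hg, ih, map_sub, map_smul, Module.End.mul_apply,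
        sub_sub, ← add_smul]
      congr 2; push_cast; ring
  induction k with
  | zero => simp [t.eg, hu]
  | succ k ih =>
    rw [pow_succ', Module.End.mul_apply, t.eg, ih, hG, map_smul, ← Module.End.mul_apply,
      ← pow_succ']
    simp only [map_sub, map_smul]
    push_cast
    module

theorem Trip.EG_const [CharZero F] (t : Trip E H G) {u : M} {μ : F} (hu : E u = 0)
    (hw : H u = μ • u) (k : ℕ) (hk : ∀ i : ℕ, i < k → μ ≠ i) :
    ∃ c : F, c ≠ 0 ∧ (E ^ k) ((G ^ k) u) = c • u := by
  induction k with
  | zero => exact ⟨1, one_ne_zero, by simp⟩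
  | succ k ih =>
    obtain ⟨c, hc, h⟩ := ih (fun i hi => hk i (by omega))
    refine ⟨((k:F)+1) * (μ - k) * c, ?_, ?_⟩
    · refine mul_ne_zero (mul_ne_zero (by exact_mod_cast Nat.succ_ne_zero k) ?_) hc
      exact sub_ne_zero.2 (hk k (by omega))
    · rw [pow_succ E, Module.End.mul_apply, t.eGpow hu, hw, ← sub_smul]
      simp only [map_smul, h, smul_smul]

theorem gen_inj {k μ : F} {x : M} (hx : H x = k • x) (hm : x ∈ H.maxGenEigenspace μ)
    (hne : k ≠ μ) : x = 0 := by
  obtain ⟨m, hm⟩ := (Module.End.mem_maxGenEigenspace _ _ _).1 hm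
  have : ∀ m : ℕ, ((H - μ • (1 : Module.End F M)) ^ m) x = (k - μ) ^ m • x := by
    intro m
    induction m with
    | zero => simp
    | succ m ih =>
      rw [pow_succ', Module.End.mul_apply, ih, map_smul]
      simp [hx, ← sub_smul, smul_smul, pow_succ]
  rw [this] at hm
  exact (smul_eq_zero.1 hm).resolve_left (pow_ne_zero _ (sub_ne_zero.2 hne))

theorem gen_sub {μ k : F} {x : M} (hm : x ∈ H.maxGenEigenspace μ) :
    H x - k • x ∈ H.maxGenEigenspace μ := by
  refine Submodule.sub_mem _ ?_ (Submodule.smul_mem _ _ hm)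
  exact Module.End.mapsTo_maxGenEigenspace_of_comm (Commute.refl H) μ hm

theorem Trip.gen_ker [CharZero F] (t : Trip E H G) (k : ℕ) : ∀ {u : M} {μ : F}, E u = 0 →
    (G ^ k) u = 0 → u ∈ H.maxGenEigenspace μ →
    H u = μ • u ∧ (u = 0 ∨ ∃ n : ℕ, n < k ∧ μ = n) := by
  induction k with
  | zero => intro u μ _ h _; simp at h; simp [h]
  | succ k ih =>
    intro u μ hE hG hm
    have h1 : (G ^ k) (H u - (k:F) • u) = 0 := by
      have := t.eGpow hE k
      rw [hG, map_zero] at this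
      exact (smul_eq_zero.1 this.symm).resolve_left (by exact_mod_cast Nat.succ_ne_zero k)
    have h2 : E (H u - (k:F) • u) = 0 := by
      have := t.he u
      rw [hE] at this
      simp only [map_zero, smul_zero, add_zero] at this
      simp [hE, ← this]
    obtain ⟨h3, h4⟩ := ih h2 h1 (gen_sub hm)
    by_cases hμ : μ = k
    · have h5 : H u - (k:F) • u = 0 := by
        rcases h4 with h4 | ⟨n, hn, h4⟩
        · exact h4
        · rw [hμ] at h4
          have : k = n := by exact_mod_cast h4
          omega
      exact ⟨by rw [hμ]; exact sub_eq_zero.1 h5, Or.inr ⟨k, by omega, hμ⟩⟩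
    · have h5 : H u - μ • u = 0 := by
        refine gen_inj (k := (k:F)) ?_ (gen_sub hm) (Ne.symm hμ)
        simp only [map_sub, map_smul, smul_sub] at h3 ⊢
        rw [sub_eq_iff_eq_add] at h3
        rw [h3, smul_smul, smul_smul, mul_comm]; abel
      have h5' := sub_eq_zero.1 h5
      refine ⟨h5', ?_⟩
      rcases h4 with h4 | ⟨n, hn, h4⟩
      · left
        exact gen_inj (k := (k:F)) (sub_eq_zero.1 h4) hm (Ne.symm hμ)
      · exact Or.inr ⟨n, by omega, h4⟩

theorem Trip.genE (t : Trip E H G) {μ : F} {v : M} (hv : v ∈ H.maxGenEigenspace μ) :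
    E v ∈ H.maxGenEigenspace (μ + 2) := by
  obtain ⟨m, hm⟩ := (Module.End.mem_maxGenEigenspace _ _ _).1 hv
  refine (Module.End.mem_maxGenEigenspace _ _ _).2 ⟨m, ?_⟩
  have : ∀ m : ℕ, ((H - (μ + 2) • (1 : Module.End F M)) ^ m) (E v)
      = E (((H - μ • (1 : Module.End F M)) ^ m) v) := by
    intro m
    induction m with
    | zero => simp
    | succ m ih =>
      rw [pow_succ', Module.End.mul_apply, ih, pow_succ', Module.End.mul_apply]
      simp [t.he, add_smul]
  rw [this, hm, map_zero]

theorem Trip.genEpow (t : Trip E H G) {μ : F} {v : M} (hv : v ∈ H.maxGenEigenspace μ) (k : ℕ) :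
    (E ^ k) v ∈ H.maxGenEigenspace (μ + 2 * k) := by
  induction k with
  | zero => simpa using hv
  | succ k ih =>
    have := t.genE ih
    rw [pow_succ', Module.End.mul_apply]
    convert this using 2
    push_cast; ring

theorem eig_gen {μ : F} {v : M} (hv : H v = μ • v) : v ∈ H.maxGenEigenspace μ :=
  Module.End.eigenspace_le_maxGenEigenspace (Module.End.mem_eigenspace_iff.2 hv)

theorem Trip.gen_nonneg [CharZero F] (t : Trip E H G) (n : ℕ) (j : ℕ) : ∀ v : M,
    (E ^ j) v = 0 → v ∈ H.maxGenEigenspace (n : F) → H v = (n : F) • v := by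
  obtain ⟨N, hN⟩ := t.nG
  induction j with
  | zero => intro v hv _; simp at hv; simp [hv]
  | succ j ih =>
    intro v hv hm
    have hEu : E ((E ^ j) v) = 0 := by rw [← Module.End.mul_apply, ← pow_succ', hv]
    obtain ⟨h1, -⟩ := t.gen_ker N hEu (hN _) (t.genEpow hm j)
    obtain ⟨c, hc, h2⟩ := t.EG_const hEu h1 j (by
      intro i hi h
      have : n + 2 * j = i := by exact_mod_cast h
      omega)
    have h3 := t.wG h1 j
    have h3' : H ((G ^ j) ((E ^ j) v)) = (n:F) • ((G ^ j) ((E ^ j) v)) := by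
      rw [h3]; congr 1; ring
    have h4 := ih (v - c⁻¹ • (G ^ j) ((E ^ j) v)) (by
      rw [map_sub, map_smul, h2, smul_smul, inv_mul_cancel₀ hc, one_smul, sub_self])
      (Submodule.sub_mem _ hm (Submodule.smul_mem _ _ (eig_gen h3')))
    rw [map_sub, map_smul, h3', smul_sub] at h4
    rw [smul_comm] at h4
    exact sub_left_injective h4

theorem gen_neg {μ : F} {v : M} (hv : v ∈ H.maxGenEigenspace μ) :
    v ∈ (-H).maxGenEigenspace (-μ) := by
  obtain ⟨m, hm⟩ := (Module.End.mem_maxGenEigenspace _ _ _).1 hv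
  refine (Module.End.mem_maxGenEigenspace _ _ _).2 ⟨m, ?_⟩
  have : (-H - (-μ) • (1 : Module.End F M)) = - (H - μ • (1 : Module.End F M)) := by
    rw [neg_smul]; abel
  rw [this, neg_pow]
  rw [Module.End.mul_apply, hm, map_zero]

theorem Trip.gen_int [CharZero F] (t : Trip E H G) (n : ℤ) {v : M}
    (hm : v ∈ H.maxGenEigenspace (n : F)) : H v = (n : F) • v := by
  obtain ⟨k, rfl | rfl⟩ := n.eq_nat_or_neg
  · obtain ⟨N, hN⟩ := t.nE
    simpa using t.gen_nonneg k N v (hN v) (by simpa using hm)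
  · obtain ⟨N, hN⟩ := t.nG
    have := t.symm.gen_nonneg k N v (hN v) (by simpa using gen_neg hm)
    rw [LinearMap.neg_apply, neg_eq_iff_eq_neg] at this
    simpa using this

/-- product of `H - j` over a list. -/
def LP (H : Module.End F M) (l : List ℤ) (v : M) : M :=
  l.foldr (fun (j:ℤ) v => H v - (j:F) • v) v

theorem LP_append (l₁ l₂ : List ℤ) (v : M) : LP H (l₁ ++ l₂) v = LP H l₁ (LP H l₂ v) := by
  simp [LP, List.foldr_append]

theorem Trip.LP_E (t : Trip E H G) (l : List ℤ) (v : M) :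
    E (LP H (l.map (· - 2)) v) = LP H l (E v) := by
  induction l with
  | nil => simp [LP]
  | cons a l ih =>
    simp only [LP, List.map_cons, List.foldr_cons] at ih ⊢
    rw [← ih, t.he]
    simp [sub_smul]
    abel

theorem LP_zero (l : List ℤ) : LP H l (0:M) = 0 := by
  induction l with
  | nil => simp [LP]
  | cons a l ih => simp only [LP, List.foldr_cons] at ih ⊢; simp [ih]

theorem Trip.LP_ker [CharZero F] (t : Trip E H G) (k : ℕ) : ∃ l : List ℤ, ∀ u : M, E u = 0 →
    (G ^ k) u = 0 → LP H l u = 0 := by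
  induction k with
  | zero => exact ⟨[], fun u _ h => by simpa [LP] using h⟩
  | succ k ih =>
    obtain ⟨l, hl⟩ := ih
    refine ⟨l ++ [(k:ℤ)], fun u hE hG => ?_⟩
    rw [LP_append]
    have h1 : (G ^ k) (H u - (k:F) • u) = 0 := by
      have := t.eGpow hE k
      rw [hG, map_zero] at this
      exact (smul_eq_zero.1 this.symm).resolve_left (by exact_mod_cast Nat.succ_ne_zero k)
    have h2 : E (H u - (k:F) • u) = 0 := by
      have := t.he u
      rw [hE] at this
      simp only [map_zero, smul_zero, add_zero] at this
      simp [hE, ← this]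
    simpa [LP] using hl _ h2 h1

theorem Trip.LP_all [CharZero F] (t : Trip E H G) : ∃ l : List ℤ, ∀ u : M, LP H l u = 0 := by
  obtain ⟨N, hN⟩ := t.nG
  obtain ⟨l, hl⟩ := t.LP_ker N
  have : ∀ k : ℕ, ∃ l : List ℤ, ∀ u : M, (E ^ k) u = 0 → LP H l u = 0 := by
    intro k
    induction k with
    | zero => exact ⟨[], fun u h => by simpa [LP] using h⟩
    | succ k ih =>
      obtain ⟨l', hl'⟩ := ih
      refine ⟨l ++ l'.map (· - 2), fun u hu => ?_⟩
      rw [LP_append]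
      refine hl _ ?_ (hN _)
      rw [t.LP_E]
      apply hl'
      rw [← Module.End.mul_apply, ← pow_succ, hu]
  obtain ⟨N', hN'⟩ := t.nE
  obtain ⟨l', hl'⟩ := this N'
  exact ⟨l', fun u => hl' u (hN' u)⟩

theorem gen_surj {n j : F} (hne : n ≠ j) (m : ℕ) : ∀ s : M,
    ((H - n • (1 : Module.End F M)) ^ m) s = 0 →
    ∃ t ∈ H.maxGenEigenspace n, s = H t - j • t := by
  induction m with
  | zero => intro s hs; exact ⟨0, Submodule.zero_mem _, by simpa using hs⟩
  | succ m ih =>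
    intro s hs
    have hs' : s ∈ H.maxGenEigenspace n := (Module.End.mem_maxGenEigenspace _ _ _).2 ⟨_, hs⟩
    rw [pow_succ, Module.End.mul_apply] at hs
    obtain ⟨t, ht, h⟩ := ih _ hs
    refine ⟨(n - j)⁻¹ • (s - t), Submodule.smul_mem _ _ (Submodule.sub_mem _ hs' ht), ?_⟩
    have hne' : n - j ≠ 0 := sub_ne_zero.2 hne
    have h' : H s - n • s = H t - j • t := by simpa using h
    have : (n - j) • s = H (s - t) - j • (s - t) := by
      rw [map_sub, smul_sub, sub_smul]
      rw [sub_eq_sub_iff_add_eq_add] at h'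
      have : H s = H t - j • t + n • s := by rw [sub_add_eq_add_sub, ← h']; abel
      rw [this]; abel
    rw [map_smul, smul_comm j, ← smul_sub, ← this, smul_smul, inv_mul_cancel₀ hne', one_smul]

theorem gen_desc [CharZero F] (j : ℤ) (v : M)
    (hv : H v - (j:F) • v ∈ ⨆ n : ℤ, H.maxGenEigenspace (n:F)) :
    v ∈ ⨆ n : ℤ, H.maxGenEigenspace (n:F) := by
  have key : ∀ s ∈ ⨆ n : ℤ, H.maxGenEigenspace (n:F),
      ∃ t ∈ ⨆ n : ℤ, H.maxGenEigenspace (n:F), s - (H t - (j:F) • t) ∈ H.maxGenEigenspace (j:F) := by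
    intro s hs
    induction hs using Submodule.iSup_induction' with
    | mem n x hx =>
      by_cases h : n = j
      · subst h
        exact ⟨0, Submodule.zero_mem _, by simpa using hx⟩
      · obtain ⟨m, hm⟩ := (Module.End.mem_maxGenEigenspace _ _ _).1 hx
        obtain ⟨t, ht, h⟩ := gen_surj (j := (j:F)) (by exact_mod_cast h) m x hm
        exact ⟨t, Submodule.mem_iSup_of_mem n ht, by rw [h, sub_self]; exact Submodule.zero_mem _⟩
    | zero => exact ⟨0, Submodule.zero_mem _, by simp⟩
    | add x y _ _ hx hy =>
      obtain ⟨a, ha, h1⟩ := hx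
      obtain ⟨b, hb, h2⟩ := hy
      refine ⟨a + b, Submodule.add_mem _ ha hb, ?_⟩
      convert Submodule.add_mem _ h1 h2 using 1
      rw [map_add, smul_add]; abel
  obtain ⟨t, ht, h⟩ := key _ hv
  have h1 : v - t ∈ H.maxGenEigenspace (j:F) := by
    have h' : H (v - t) - (j:F) • (v - t) ∈ H.maxGenEigenspace (j:F) := by
      convert h using 1
      rw [map_sub, smul_sub]; abel
    obtain ⟨m, hm⟩ := (Module.End.mem_maxGenEigenspace _ _ _).1 h'
    refine (Module.End.mem_maxGenEigenspace _ _ _).2 ⟨m+1, ?_⟩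
    rw [pow_succ, Module.End.mul_apply]
    simpa using hm
  have := Submodule.add_mem _ ht (Submodule.mem_iSup_of_mem (p := fun n : ℤ => H.maxGenEigenspace (n:F)) j h1)
  simpa using this

theorem Trip.iSup_top [CharZero F] (t : Trip E H G) :
    ⨆ n : ℤ, H.eigenspace (n:F) = ⊤ := by
  have h1 : ⨆ n : ℤ, H.maxGenEigenspace (n:F) = ⊤ := by
    obtain ⟨l, hl⟩ := t.LP_all
    rw [eq_top_iff]
    intro v _
    have : ∀ (l : List ℤ), LP H l v ∈ ⨆ n : ℤ, H.maxGenEigenspace (n:F) →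
        v ∈ ⨆ n : ℤ, H.maxGenEigenspace (n:F) := by
      intro l
      induction l with
      | nil => simp [LP]
      | cons a l ih => intro h; exact ih (gen_desc a _ (by simpa [LP] using h))
    exact this l (by rw [hl]; exact Submodule.zero_mem _)
  rw [eq_top_iff, ← h1]
  exact iSup_mono fun n v hv => Module.End.mem_eigenspace_iff.2 (t.gen_int n hv)

/-- eigenvectors of weight at least one are in the image of `E`. -/
theorem Trip.surjE [CharZero F] (t : Trip E H G) {n : ℤ} (hn : 1 ≤ n) (v : M)
    (hv : H v = (n:F) • v) : ∃ x, H x = ((n - 2 : ℤ) : F) • x ∧ E x = v := by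
  have : ∀ j : ℕ, ∀ v : M, (E ^ j) v = 0 → H v = (n:F) • v →
      ∃ x, H x = ((n - 2 : ℤ) : F) • x ∧ E x = v := by
    intro j
    induction j with
    | zero => intro v h _; exact ⟨0, by simp, by simpa using h.symm⟩
    | succ j ih =>
      intro v hv hw
      have hEu : E ((E ^ j) v) = 0 := by rw [← Module.End.mul_apply, ← pow_succ', hv]
      have h1 := t.wE hw j
      obtain ⟨c, hc, h2⟩ := t.EG_const hEu h1 j (by
        intro i hi h
        have : n + 2 * j = i := by exact_mod_cast h
        omega)
      have h3 := t.wG h1 j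
      have h3' : H ((G ^ j) ((E ^ j) v)) = (n:F) • ((G ^ j) ((E ^ j) v)) := by
        rw [h3]; congr 1; ring
      obtain ⟨x, hx1, hx2⟩ := ih (v - c⁻¹ • (G ^ j) ((E ^ j) v)) (by
        rw [map_sub, map_smul, h2, smul_smul, inv_mul_cancel₀ hc, one_smul, sub_self]) (by
        rw [map_sub, map_smul, h3', hw, smul_sub, smul_comm])
      have h4 := t.eGpow hEu j
      rw [h1, ← sub_smul, map_smul, smul_smul] at h4
      set d : F := ((j:F) + 1) * ((n:F) + 2 * j - j) with hd
      have hd0 : d ≠ 0 := by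
        rw [hd]
        refine mul_ne_zero (by exact_mod_cast Nat.succ_ne_zero j) ?_
        have : (n + 2 * j - j : ℤ) ≠ 0 := by omega
        exact_mod_cast this
      refine ⟨x + (c⁻¹ * d⁻¹) • (G ^ (j+1)) ((E ^ j) v), ?_, ?_⟩
      · rw [map_add, map_smul, t.wG h1 (j+1), hx1, smul_add, smul_comm]
        congr 2; push_cast; ring
      · rw [map_add, hx2, map_smul, h4, smul_smul, mul_assoc, inv_mul_cancel₀ hd0, mul_one]
        abel
  obtain ⟨N, hN⟩ := t.nE
  exact this N v (hN v) hv

theorem Trip.surjG [CharZero F] (t : Trip E H G) {n : ℤ} (hn : n ≤ -1) (v : M)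
    (hv : H v = (n:F) • v) : ∃ x, H x = ((n + 2 : ℤ) : F) • x ∧ G x = v := by
  obtain ⟨x, h1, h2⟩ := t.symm.surjE (n := -n) (by omega) v (by simp [hv])
  refine ⟨x, ?_, h2⟩
  rw [LinearMap.neg_apply, neg_eq_iff_eq_neg, ← neg_smul] at h1
  rw [h1]; congr 1; push_cast; ring

theorem Trip.injE [CharZero F] (t : Trip E H G) {n : ℤ} (hn : n ≤ -1) (v : M)
    (hv : H v = (n:F) • v) (h : E v = 0) : v = 0 := by
  obtain ⟨N, hN⟩ := t.nG
  refine (t.gen_ker N h (hN v) (eig_gen hv)).2.resolve_right ?_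
  rintro ⟨m, -, hm⟩
  have : n = m := by exact_mod_cast hm
  omega

theorem Trip.injG [CharZero F] (t : Trip E H G) {n : ℤ} (hn : 1 ≤ n) (v : M)
    (hv : H v = (n:F) • v) (h : G v = 0) : v = 0 :=
  t.symm.injE (n := -n) (by omega) v (by simp [hv]) h

end General
end Sl2Aux
namespace Sl2Aux
section Comb

theorem abs_sum (M a b : ℤ) (ha : -M ≤ a ∧ a ≤ M) (hb : -M ≤ b ∧ b ≤ M) :
    ∑ t ∈ Finset.Ico (-M) M, ((if a ≤ t then (1:ℤ) else 0) - (if b ≤ t then 1 else 0)) ^ 2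
      = |a - b| := by
  wlog hab : a ≤ b generalizing a b
  · have := this b a hb ha (by omega)
    rw [abs_sub_comm, ← this]
    refine Finset.sum_congr rfl fun t _ => by ring
  have h1 : ∀ t ∈ Finset.Ico (-M) M,
      ((if a ≤ t then (1:ℤ) else 0) - (if b ≤ t then 1 else 0)) ^ 2
        = if a ≤ t ∧ t < b then 1 else 0 := by
    intro t _
    split_ifs <;> omega
  rw [Finset.sum_congr rfl h1, Finset.sum_boole]
  have h2 : Finset.filter (fun t => a ≤ t ∧ t < b) (Finset.Ico (-M) M) = Finset.Ico a b := by
    ext t; simp only [Finset.mem_filter, Finset.mem_Ico]; omega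
  rw [h2, Int.card_Ico, abs_of_nonpos (by omega)]
  simp; omega

variable {ι : Type*} [Fintype ι]

def S (w σ : ι → ℤ) (t : ℤ) : ℤ := ∑ a, if w a ≤ t then σ a else 0

theorem neg_sum (w σ : ι → ℤ) (hsum : ∑ a, σ a = -1) (M : ℤ) (hM : ∀ a, -M ≤ w a ∧ w a ≤ M) :
    -∑ a, ∑ b, σ a * σ b * |w a - w b| = ∑ t ∈ Finset.Ico (-M) M, 2 * (S w σ t * (S w σ t + 1)) := by
  have h1 : ∑ a, ∑ b, σ a * σ b * |w a - w b| = ∑ t ∈ Finset.Ico (-M) M, ∑ a, ∑ b,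
      σ a * σ b * ((if w a ≤ t then (1:ℤ) else 0) - (if w b ≤ t then 1 else 0)) ^ 2 := by
    rw [Finset.sum_comm]
    rw [Finset.sum_comm]
    rw [Finset.sum_comm (s := Finset.Ico (-M) M)]
    refine Finset.sum_congr rfl fun a _ => ?_
    rw [Finset.sum_comm (s := Finset.Ico (-M) M)]
    refine Finset.sum_congr rfl fun b _ => ?_
    rw [← Finset.mul_sum, abs_sum M _ _ (hM a) (hM b)]
  rw [h1, ← Finset.sum_neg_distrib]
  refine Finset.sum_congr rfl fun t _ => ?_
  have h2 : ∀ a b, σ a * σ b * ((if w a ≤ t then (1:ℤ) else 0) - (if w b ≤ t then 1 else 0)) ^ 2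
      = (if w a ≤ t then σ a else 0) * σ b + σ a * (if w b ≤ t then σ b else 0)
        - 2 * ((if w a ≤ t then σ a else 0) * (if w b ≤ t then σ b else 0)) := by
    intro a b; split_ifs <;> ring
  simp only [h2, Finset.sum_sub_distrib, Finset.sum_add_distrib, ← Finset.mul_sum, ← Finset.sum_mul,
    hsum]
  simp only [S]; ring

theorem comb (w σ : ι → ℤ) (hσ : ∀ a, σ a = 1 ∨ σ a = -1) (hsum : ∑ a, σ a = -1)
    (htr : (∑ a, ∑ b, if σ a * σ b = -1 ∧ w a - w b ≤ 0 then 2 - (w a - w b) else 0)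
      + (∑ a, ∑ b, if σ a * σ b = 1 ∧ w a - w b ≤ -2 then (w a - w b) else 0)
      = ∑ a, ∑ b, if σ a * σ b = -1 then 1 else 0) :
    (∀ a b, σ a * σ b = -1 → w a ≠ w b) ∧ ∀ t, S w σ t = 0 ∨ S w σ t = -1 := by
  obtain ⟨M, hM⟩ : ∃ M : ℤ, ∀ a, -M ≤ w a ∧ w a ≤ M := by
    refine ⟨∑ a, |w a|, fun a => ?_⟩
    have := Finset.single_le_sum (f := fun a => |w a|) (fun i _ => abs_nonneg _) (Finset.mem_univ a)
    exact abs_le.1 this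
  have hn := neg_sum w σ hsum M hM
  set φ : ι → ι → ℤ := fun a b =>
    (if σ a * σ b = -1 ∧ w a - w b ≤ 0 then 2 - (w a - w b) else 0)
    + (if σ a * σ b = 1 ∧ w a - w b ≤ -2 then (w a - w b) else 0)
    - (if σ a * σ b = -1 then 1 else 0) with hφ
  have h0 : ∑ a, ∑ b, φ a b = 0 := by
    simp only [hφ, Finset.sum_sub_distrib, Finset.sum_add_distrib]
    omega
  have h0' : ∑ a, ∑ b, φ b a = 0 := by rw [Finset.sum_comm]; exact h0
  have hpt : ∀ a b, φ a b + φ b a = (if σ a * σ b = -1 ∧ w a = w b then 2 else 0)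
      + (if σ a * σ b = 1 ∧ |w a - w b| = 1 then 1 else 0) + - (σ a * σ b * |w a - w b|) := by
    intro a b
    simp only [hφ]
    rcases hσ a with h1 | h1 <;> rcases hσ b with h2 | h2 <;> rw [h1, h2] <;> norm_num <;>
    rcases abs_cases (w a - w b) with ⟨h3, h4⟩ | ⟨h3, h4⟩ <;> rw [h3] <;> split_ifs <;> omega
  have h1 : ∑ a, ∑ b, (φ a b + φ b a) = 0 := by
    simp only [Finset.sum_add_distrib]; rw [h0, h0']; rfl
  simp only [hpt, Finset.sum_add_distrib, Finset.sum_neg_distrib] at h1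
  rw [hn] at h1
  have hA : ∀ a b, 0 ≤ (if σ a * σ b = -1 ∧ w a = w b then (2:ℤ) else 0) := by
    intro a b; split_ifs <;> norm_num
  have hB : 0 ≤ ∑ a, ∑ b, (if σ a * σ b = 1 ∧ |w a - w b| = 1 then (1:ℤ) else 0) :=
    Finset.sum_nonneg fun a _ => Finset.sum_nonneg fun b _ => by split_ifs <;> norm_num
  have hC : ∀ t, 0 ≤ 2 * (S w σ t * (S w σ t + 1)) := by
    intro t
    rcases le_or_gt 0 (S w σ t) with h | h
    · positivity
    · have : 0 ≤ (-S w σ t) * (-(S w σ t + 1)) := mul_nonneg (by omega) (by omega)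
      nlinarith
  have hA' := Finset.sum_nonneg fun a (_ : a ∈ Finset.univ) =>
    Finset.sum_nonneg fun b (_ : b ∈ Finset.univ) => hA a b
  have hC' := Finset.sum_nonneg fun t (_ : t ∈ Finset.Ico (-M) M) => hC t
  constructor
  · intro a b hab hw
    have e1 := (Finset.sum_eq_zero_iff_of_nonneg (fun a (_ : a ∈ Finset.univ) =>
      Finset.sum_nonneg fun b (_ : b ∈ Finset.univ) => hA a b)).1 (by omega) a (Finset.mem_univ _)
    have e2 := (Finset.sum_eq_zero_iff_of_nonneg (fun b _ => hA a b)).1 e1 b (Finset.mem_univ _)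
    rw [if_pos ⟨hab, hw⟩] at e2
    omega
  · intro t
    by_cases ht : t < -M
    · left
      refine Finset.sum_eq_zero fun a _ => ?_
      rw [if_neg]; have := hM a; omega
    by_cases ht' : M ≤ t
    · right
      rw [← hsum]
      refine Finset.sum_congr rfl fun a _ => ?_
      rw [if_pos]; have := hM a; omega
    have e1 := (Finset.sum_eq_zero_iff_of_nonneg (fun t _ => hC t)).1
      (by omega : ∑ t ∈ Finset.Ico (-M) M, 2 * (S w σ t * (S w σ t + 1)) = 0) t
      (by simp only [Finset.mem_Ico]; omega)
    have e2 : S w σ t * (S w σ t + 1) = 0 := by omega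
    rcases mul_eq_zero.1 e2 with h | h
    · left; exact h
    · right; omega

theorem S_step (w σ : ι → ℤ) (t : ℤ) :
    S w σ t - S w σ (t - 1) = ∑ a, if w a = t then σ a else 0 := by
  simp only [S, ← Finset.sum_sub_distrib]
  refine Finset.sum_congr rfl fun a _ => ?_
  split_ifs <;> omega

theorem comb_inj [DecidableEq ι] (w σ : ι → ℤ) (hσ : ∀ a, σ a = 1 ∨ σ a = -1)
    (h1 : ∀ a b, σ a * σ b = -1 → w a ≠ w b) (h2 : ∀ t, S w σ t = 0 ∨ S w σ t = -1) :
    Function.Injective w := by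
  intro a b hab
  by_contra hne
  have h3 := S_step w σ (w a)
  have h4 : ∀ c, w c = w a → σ c = σ a := by
    intro c hc
    by_contra hcon
    refine h1 c a ?_ hc
    rcases hσ a with h | h <;> rcases hσ c with h' | h' <;>
      first | exact absurd (h'.trans h.symm) hcon | (rw [h, h']; norm_num)
  have h5 : (∑ c, if w c = w a then σ c else 0)
      = σ a * ∑ c, if w c = w a then (1:ℤ) else 0 := by
    rw [Finset.mul_sum]
    refine Finset.sum_congr rfl fun c _ => ?_
    split_ifs with h
    · rw [h4 c h, mul_one]
    · simp
  have h6 : (2:ℤ) ≤ ∑ c, if w c = w a then (1:ℤ) else 0 := by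
    have : ∑ c ∈ ({a, b} : Finset ι), (if w c = w a then (1:ℤ) else 0) = 2 := by
      rw [Finset.sum_pair hne]; simp [hab]
    rw [← this]
    refine Finset.sum_le_sum_of_subset_of_nonneg (Finset.subset_univ _) fun c _ _ => ?_
    split_ifs <;> norm_num
  rw [h5] at h3
  have h7 := h2 (w a)
  have h8 := h2 (w a - 1)
  rcases hσ a with h | h <;> rw [h] at h3 <;> omega

theorem comb_even (w σ : ι → ℤ) (hσ : ∀ a, σ a = 1 ∨ σ a = -1)
    (hinj : Function.Injective w) (h2 : ∀ t, S w σ t = 0 ∨ S w σ t = -1)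
    (hE : ∀ a, w a ≤ -1 → ∃ c, w c = w a + 2 ∧ σ c = - σ a)
    (hG : ∀ a, 1 ≤ w a → ∃ c, w c = w a - 2 ∧ σ c = - σ a)
    (hw : ∑ a, w a = 0) (hcard : Odd (Fintype.card ι)) : ∀ a, Even (w a) := by
  have hs : ∀ a, S w σ (w a) - S w σ (w a - 1) = σ a := by
    intro a
    rw [S_step, Finset.sum_eq_single a]
    · simp
    · intro b _ hb
      rw [if_neg]; intro h; exact hb (hinj h)
    · simp
  have hdown : ∀ n : ℕ, ∀ a, (w a).natAbs = n → ∃ b, (w b = 0 ∨ w b = 1 ∨ w b = -1)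
      ∧ (Even (w b) ↔ Even (w a)) := by
    intro n
    induction n using Nat.strong_induction_on with
    | _ n ih =>
      intro a ha
      by_cases h : n ≤ 1
      · exact ⟨a, by omega, Iff.rfl⟩
      rcases le_or_gt (w a) 0 with h' | h'
      · obtain ⟨c, hc, -⟩ := hE a (by omega)
        obtain ⟨b, hb, hb'⟩ := ih (w c).natAbs (by omega) c rfl
        refine ⟨b, hb, hb'.trans ?_⟩
        rw [hc, Int.even_add]; simp
      · obtain ⟨c, hc, -⟩ := hG a (by omega)
        obtain ⟨b, hb, hb'⟩ := ih (w c).natAbs (by omega) c rfl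
        refine ⟨b, hb, hb'.trans ?_⟩
        rw [hc, Int.even_sub]; simp
  by_contra! hodd
  obtain ⟨a, ha⟩ := hodd
  obtain ⟨b, hb, hba⟩ := hdown _ a rfl
  have hpm : ∃ c d, w c = 1 ∧ w d = -1 ∧ σ d = - σ c := by
    rcases hb with hb | hb | hb
    · rw [hb] at hba; simp at hba; exact absurd hba (by simpa using ha)
    · obtain ⟨d, hd, hd'⟩ := hG b (by omega)
      exact ⟨b, d, hb, by omega, hd'⟩
    · obtain ⟨d, hd, hd'⟩ := hE b (by omega)
      exact ⟨d, b, by omega, hb, by omega⟩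
  obtain ⟨c, d, hc, hd, hcd⟩ := hpm
  have hall : ∀ x, Odd (w x) := by
    intro x
    rw [← Int.not_even_iff_odd]
    intro hx
    obtain ⟨y, hy, hyx⟩ := hdown _ x rfl
    have hy0 : w y = 0 := by
      rcases hy with hy | hy | hy
      · exact hy
      · rw [hy] at hyx; simp at hyx; exact absurd hx (by simpa using hyx)
      · rw [hy] at hyx; simp at hyx; exact absurd hx (by simpa using hyx)
    have s1 := hs c
    have s2 := hs d
    have s3 := hs y
    rw [hc] at s1; rw [hd] at s2; rw [hy0] at s3
    norm_num at s1 s2 s3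
    have := h2 1; have := h2 0; have := h2 (-1); have := h2 (-2)
    rcases hσ c with h | h <;> rcases hσ y with h' | h' <;> omega
  have : Odd (∑ x, w x) := by
    choose k hk using hall
    simp only [hk, Finset.sum_add_distrib, ← Finset.mul_sum]
    obtain ⟨m, hm⟩ := hcard
    refine ⟨∑ i, k i + m, ?_⟩
    simp [hm]; ring
  rw [hw] at this
  simp at this

end Comb
end Sl2Aux
namespace Sl2Aux
section Tr
set_option linter.unusedSectionVars false
variable {F : Type*} [Field F] {ι : Type*} [Fintype ι] [DecidableEq ι]

theorem matAd_apply (A m : Matrix ι ι F) : matAd F A m = A * m - m * A := by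
  simp [matAd]

/-- restrict a matrix to a set of entries -/
noncomputable def pr (P : ι → ι → Prop) [∀ a b, Decidable (P a b)] (m : Matrix ι ι F) : Matrix ι ι F :=
  Matrix.of fun a b => if P a b then m a b else 0

theorem pr_ad {f : Matrix ι ι F} (P Q : ι → ι → Prop)
    [∀ a b, Decidable (P a b)] [∀ a b, Decidable (Q a b)]
    (h1 : ∀ a c b, f a c ≠ 0 → (P c b ↔ Q a b)) (h2 : ∀ a c b, f c b ≠ 0 → (P a c ↔ Q a b))
    (m : Matrix ι ι F) : matAd F f (pr P m) = pr Q (matAd F f m) := by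
  ext a b
  simp only [matAd_apply, pr, Matrix.sub_apply, Matrix.mul_apply, Matrix.of_apply]
  have e1 : ∀ c, f a c * (if P c b then m c b else 0) = if Q a b then f a c * m c b else 0 := by
    intro c
    by_cases hf : f a c = 0
    · simp [hf]
    · simp [h1 a c b hf]
  have e2 : ∀ c, (if P a c then m a c else 0) * f c b = if Q a b then m a c * f c b else 0 := by
    intro c
    by_cases hf : f c b = 0
    · simp [hf]
    · simp [h2 a c b hf]
  simp only [e1, e2]
  split_ifs <;> simp

/-- extension by zero -/
noncomputable def ext (X : ι × ι → Prop) [DecidablePred X] : ({q // X q} → F) →ₗ[F] Matrix ι ι F where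
  toFun v := Matrix.of fun a b => if h : X (a, b) then v ⟨(a, b), h⟩ else 0
  map_add' v v' := by ext a b; simp only [Matrix.of_apply, Matrix.add_apply]; split_ifs <;> simp
  map_smul' c v := by ext a b; simp only [Matrix.of_apply, Matrix.smul_apply]; split_ifs <;> simp

noncomputable def res (X : ι × ι → Prop) : Matrix ι ι F →ₗ[F] ({q // X q} → F) where
  toFun m q := m q.1.1 q.1.2
  map_add' v v' := by ext; simp
  map_smul' c v := by ext; simp

theorem res_ext (X : ι × ι → Prop) [DecidablePred X] (v : {q // X q} → F) :
    res X (ext X v) = v := by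
  ext ⟨⟨a, b⟩, h⟩
  simp [res, ext, h]

theorem ext_res (X : ι × ι → Prop) [DecidablePred X] (m : Matrix ι ι F) :
    ext X (res X m) = pr (fun a b => X (a, b)) m := by
  ext a b
  simp [res, ext, pr]

theorem pr_eq {P : ι → ι → Prop} [∀ a b, Decidable (P a b)] {m : Matrix ι ι F}
    (h : ∀ a b, m a b ≠ 0 → P a b) : pr P m = m := by
  ext a b
  simp only [pr, Matrix.of_apply]
  split_ifs with h'
  · rfl
  · by_contra h''
    exact h' (h a b (Ne.symm h''))

theorem ad_diag (w : ι → ℤ) (m : Matrix ι ι F) (a b : ι) :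
    matAd F (Matrix.diagonal fun a => (w a : F)) m a b = ((w a - w b : ℤ) : F) * m a b := by
  simp [matAd_apply]; ring

theorem weight_of {w : ι → ℤ} [CharZero F] {x : Matrix ι ι F} {n : ℤ}
    (hx : matAd F (Matrix.diagonal fun a => (w a : F)) x = (n : F) • x) (a b : ι)
    (h : x a b ≠ 0) : w a - w b = n := by
  have := congrFun (congrFun hx a) b
  rw [ad_diag, Matrix.smul_apply, smul_eq_mul] at this
  exact_mod_cast mul_right_cancel₀ h this

theorem trace_formula [CharZero F] (w σ : ι → ℤ) (hσ : ∀ a, σ a = 1 ∨ σ a = -1)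
    (e f : Matrix ι ι F)
    (t : Trip (matAd F e) (matAd F (Matrix.diagonal fun a => (w a : F))) (matAd F f))
    (hfσ : ∀ a b, f a b ≠ 0 → σ a * σ b = -1)
    (hfw : ∀ a b, f a b ≠ 0 → w a - w b = -2)
    (S : Submodule F (Matrix ι ι F))
    (hS : ∀ m, m ∈ S ↔ (∀ a b, m a b ≠ 0 → σ a * σ b = -1) ∧ matAd F f m = 0)
    (T : Module.End F S)
    (hT : ∀ m : S, (T m : Matrix ι ι F) = (2 : F) • (m : Matrix ι ι F)
      - matAd F (Matrix.diagonal fun a => (w a : F)) (m : Matrix ι ι F)) :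
    LinearMap.trace F S T =
    (((∑ a, ∑ b, if σ a * σ b = -1 ∧ w a - w b ≤ 0 then 2 - (w a - w b) else 0)
      + (∑ a, ∑ b, if σ a * σ b = 1 ∧ w a - w b ≤ -2 then (w a - w b) else 0) : ℤ) : F) := by
  classical
  set X : ι × ι → Prop := fun q => σ q.1 * σ q.2 = -1 ∧ w q.1 - w q.2 ≤ 0 with hX
  set Y : ι × ι → Prop := fun q => σ q.1 * σ q.2 = 1 ∧ w q.1 - w q.2 ≤ -2 with hY
  set H := matAd F (Matrix.diagonal fun a => (w a : F)) with hH
  set dX : {q // X q} → F := fun q => ((2 - (w q.1.1 - w q.1.2) : ℤ) : F) with hdX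
  set dY : {q // Y q} → F := fun q => ((- (w q.1.1 - w q.1.2) : ℤ) : F) with hdY
  set DX : Module.End F ({q // X q} → F) := Matrix.toLin' (Matrix.diagonal dX) with hDX
  set DY : Module.End F ({q // Y q} → F) := Matrix.toLin' (Matrix.diagonal dY) with hDY
  set φ : ({q // X q} → F) →ₗ[F] ({q // Y q} → F) := res Y ∘ₗ matAd F f ∘ₗ ext X with hφ
  have sg : ∀ a c b, f a c ≠ 0 → (σ c * σ b = -1 ↔ σ a * σ b = 1) := by
    intro a c b h
    have := hfσ a c h
    rcases hσ a with h1 | h1 <;> rcases hσ b with h2 | h2 <;> rcases hσ c with h3 | h3 <;>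
      rw [h1, h3] at this <;> rw [h1, h2, h3] <;> norm_num at *
  have sg' : ∀ a c b, f c b ≠ 0 → (σ a * σ c = -1 ↔ σ a * σ b = 1) := by
    intro a c b h
    have := hfσ c b h
    rcases hσ a with h1 | h1 <;> rcases hσ b with h2 | h2 <;> rcases hσ c with h3 | h3 <;>
      rw [h2, h3] at this <;> rw [h1, h2, h3] <;> norm_num at *
  have prXY : ∀ m, matAd F f (pr (fun a b => X (a, b)) m)
      = pr (fun a b => Y (a, b)) (matAd F f m) := by
    apply pr_ad
    · intro a c b h
      have h1 := sg a c b h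
      have h2 := hfw a c h
      simp only [hX, hY, h1]
      constructor <;> rintro ⟨h3, h4⟩ <;> exact ⟨h3, by omega⟩
    · intro a c b h
      have h1 := sg' a c b h
      have h2 := hfw c b h
      simp only [hX, hY, h1]
      constructor <;> rintro ⟨h3, h4⟩ <;> exact ⟨h3, by omega⟩
  have prO : ∀ m, matAd F f (pr (fun a b => σ a * σ b = -1) m)
      = pr (fun a b => σ a * σ b = 1) (matAd F f m) := pr_ad _ _ sg sg'
  have prW : ∀ n : ℤ, ∀ m, matAd F f (pr (fun a b => w a - w b = n) m)
      = pr (fun a b => w a - w b = n - 2) (matAd F f m) := by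
    intro n
    apply pr_ad
    · intro a c b h
      have h2 := hfw a c h
      omega
    · intro a c b h
      have h2 := hfw c b h
      omega
  have hext : ∀ v, matAd F f (ext X v) = ext Y (φ v) := by
    intro v
    have := prXY (ext X v)
    have e1 := ext_res X (ext X v)
    have e2 := ext_res Y (matAd F f (ext X v))
    rw [res_ext] at e1
    rw [← e1, ← e2] at this
    exact this
  have hDXres : ∀ m, res X ((2:F) • m - H m) = DX (res X m) := by
    intro m
    ext q
    simp only [res, LinearMap.coe_mk, AddHom.coe_mk, Matrix.sub_apply, Matrix.smul_apply, hH, ad_diag,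
      hDX, Matrix.toLin'_apply, Matrix.mulVec_diagonal, hdX, smul_eq_mul]
    push_cast; ring
  have hDYres : ∀ m, res Y (- H m) = DY (res Y m) := by
    intro m
    ext q
    simp only [res, LinearMap.coe_mk, AddHom.coe_mk, Matrix.neg_apply, hH, ad_diag,
      hDY, Matrix.toLin'_apply, Matrix.mulVec_diagonal, hdY]
    push_cast; ring
  have hDext : ∀ v, ext X (DX v) = (2:F) • ext X v - H (ext X v) := by
    intro v
    ext a b
    simp only [Matrix.sub_apply, Matrix.smul_apply, hH, ad_diag, smul_eq_mul]
    simp only [ext, LinearMap.coe_mk, AddHom.coe_mk, Matrix.of_apply,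
      hDX, Matrix.toLin'_apply, Matrix.mulVec_diagonal, hdX]
    split_ifs
    · push_cast; ring
    · simp
  have hcomm : φ ∘ₗ DX = DY ∘ₗ φ := by
    apply LinearMap.ext
    intro v
    simp only [hφ, LinearMap.comp_apply, hDext, ← hDYres]
    congr 1
    rw [map_sub, map_smul, t.hg]
    abel
  have hsupp : ∀ m ∈ S, pr (fun a b => X (a, b)) m = m := by
    intro m hm
    obtain ⟨h1, h2⟩ := (hS m).1 hm
    refine pr_eq fun a b hab => ⟨h1 a b hab, ?_⟩
    by_contra hlt
    have hlt : 1 ≤ w a - w b := by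
      have h' : ¬ (w a - w b ≤ 0) := hlt
      omega
    have h3 := prW (w a - w b) m
    have h4 : H (pr (fun a' b' => w a' - w b' = w a - w b) m)
        = ((w a - w b : ℤ) : F) • (pr (fun a' b' => w a' - w b' = w a - w b) m) := by
      ext a' b'
      rw [hH, ad_diag, Matrix.smul_apply, smul_eq_mul]
      simp only [pr, Matrix.of_apply]
      split_ifs with h
      · rw [h]
      · simp
    have h5 := t.injG hlt _ h4 (by
      rw [h3, h2]; ext; simp [pr])
    have h6 := congrFun (congrFun h5 a) b
    simp [pr] at h6
    exact hab h6
  have hsurj : Function.Surjective φ := by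
    rw [← LinearMap.range_eq_top, eq_top_iff, ← (Pi.basisFun F {q // Y q}).span_eq,
      Submodule.span_le]
    rintro _ ⟨⟨⟨a, b⟩, hq⟩, rfl⟩
    set y := (Pi.basisFun F {q // Y q}) ⟨⟨a, b⟩, hq⟩ with hy
    have hN : H (ext Y y) = ((w a - w b : ℤ) : F) • ext Y y := by
      ext a' b'
      rw [hH, ad_diag, Matrix.smul_apply, smul_eq_mul]
      by_cases hab : a' = a ∧ b' = b
      · rw [hab.1, hab.2]
      · have : ext Y y a' b' = 0 := by
          simp only [ext, LinearMap.coe_mk, AddHom.coe_mk, Matrix.of_apply, hy]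
          split_ifs with h
          · simp only [Pi.basisFun_apply]
            rw [Pi.single_eq_of_ne]
            intro h'
            simp only [Subtype.mk.injEq, Prod.mk.injEq] at h'
            exact hab h'
          · rfl
        simp [this]
    obtain ⟨x, hx1, hx2⟩ := t.surjG (by have := hq.2; simp only at this; omega) _ hN
    refine ⟨res X x, ?_⟩
    have hw := weight_of hx1
    have e1 : pr (fun a b => X (a, b)) x = pr (fun a b => σ a * σ b = -1) x := by
      ext a' b'
      simp only [pr, Matrix.of_apply, hX]
      by_cases h0 : x a' b' = 0
      · simp [h0]
      · have h1 := hw a' b' h0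
        have h2 := hq.2
        simp only at h2
        have h3 : w a' - w b' ≤ 0 := by omega
        simp only [h3, and_true]
    have e2 : φ (res X x) = res Y (matAd F f (ext X (res X x))) := rfl
    rw [e2, ext_res, e1, prO, hx2, pr_eq, res_ext]
    intro a' b' h
    by_contra hcon
    apply h
    simp only [ext, LinearMap.coe_mk, AddHom.coe_mk, Matrix.of_apply]
    rw [dif_neg]
    intro h'
    exact hcon h'.1
  obtain ⟨s, hs⟩ := LinearMap.exists_rightInverse_of_surjective φ (LinearMap.range_eq_top.2 hsurj)
  have hrmem : ∀ v, (ext X ∘ₗ (LinearMap.id - s ∘ₗ φ)) v ∈ S := by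
    intro v
    have e0 : (ext X ∘ₗ (LinearMap.id - s ∘ₗ φ)) v = ext X (v - s (φ v)) := rfl
    rw [hS, e0]
    constructor
    · intro a b h
      by_contra hcon
      apply h
      simp only [ext, LinearMap.coe_mk, AddHom.coe_mk, Matrix.of_apply]
      rw [dif_neg]
      intro h'
      exact hcon h'.1
    · rw [hext]
      have : φ (v - s (φ v)) = 0 := by
        have := LinearMap.congr_fun hs (φ v)
        simp only [LinearMap.comp_apply, LinearMap.id_apply] at this
        simp [this]
      rw [this, map_zero]
  set r : ({q // X q} → F) →ₗ[F] S :=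
    LinearMap.codRestrict S (ext X ∘ₗ (LinearMap.id - s ∘ₗ φ)) hrmem with hr
  set i : S →ₗ[F] ({q // X q} → F) := res X ∘ₗ S.subtype with hi
  have hri : r ∘ₗ i = LinearMap.id := by
    apply LinearMap.ext
    intro m
    apply Subtype.ext
    have h0 : φ (res X (m : Matrix ι ι F)) = 0 := by
      have e2 : φ (res X (m : Matrix ι ι F)) = res Y (matAd F f (ext X (res X (m : Matrix ι ι F)))) := rfl
      rw [e2, ext_res, hsupp _ m.2, ((hS _).1 m.2).2, map_zero]
    have : ((r ∘ₗ i) m : Matrix ι ι F) = ext X (res X (m : Matrix ι ι F) - s (φ (res X (m : Matrix ι ι F)))) := rfl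
    rw [this, h0, map_zero, sub_zero, ext_res, hsupp _ m.2]
    rfl
  have hir : i ∘ₗ r = LinearMap.id - s ∘ₗ φ := by
    apply LinearMap.ext
    intro v
    exact res_ext X _
  have hiT : i ∘ₗ T = DX ∘ₗ i := by
    apply LinearMap.ext
    intro m
    have : (i ∘ₗ T) m = res X (T m : Matrix ι ι F) := rfl
    rw [this, hT, hDXres]
    rfl
  have h1 : LinearMap.trace F S T = LinearMap.trace F _ DX - LinearMap.trace F _ DY := by
    calc LinearMap.trace F S T = LinearMap.trace F S ((r ∘ₗ i) ∘ₗ T) := by rw [hri]; rfl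
      _ = LinearMap.trace F S (r ∘ₗ (DX ∘ₗ i)) := by rw [LinearMap.comp_assoc, hiT]
      _ = LinearMap.trace F _ ((DX ∘ₗ i) ∘ₗ r) := LinearMap.trace_comp_comm' _ _
      _ = LinearMap.trace F _ (DX - DX ∘ₗ s ∘ₗ φ) := by
        rw [LinearMap.comp_assoc, hir, LinearMap.comp_sub]; rfl
      _ = LinearMap.trace F _ DX - LinearMap.trace F _ ((DX ∘ₗ s) ∘ₗ φ) := by
        rw [map_sub, LinearMap.comp_assoc]
      _ = LinearMap.trace F _ DX - LinearMap.trace F _ (φ ∘ₗ (DX ∘ₗ s)) := by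
        rw [LinearMap.trace_comp_comm']
      _ = _ := by
        rw [← LinearMap.comp_assoc, hcomm, LinearMap.comp_assoc, hs]; rfl
  have hsum : ∀ (Z : ι × ι → Prop) [DecidablePred Z] (g : ι × ι → ℤ),
      ∑ q : {q // Z q}, ((g q.1 : ℤ) : F) = ((∑ a, ∑ b, if Z (a, b) then g (a, b) else 0 : ℤ) : F) := by
    intro Z _ g
    rw [← Fintype.sum_prod_type' (f := fun a b => if Z (a, b) then g (a, b) else 0)]
    rw [← Finset.sum_filter]
    rw [Int.cast_sum]
    exact (Finset.sum_subtype (p := Z) (Finset.univ.filter Z) (by simp) (fun q => ((g q : ℤ) : F))).symm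
  rw [h1, hDX, hDY, Matrix.trace_toLin'_eq, Matrix.trace_toLin'_eq, Matrix.trace_diagonal,
    Matrix.trace_diagonal, hdX, hdY]
  rw [hsum X (fun q => 2 - (w q.1 - w q.2)), hsum Y (fun q => -(w q.1 - w q.2))]
  rw [← Int.cast_sub, sub_eq_add_neg, ← Finset.sum_neg_distrib]
  simp only [← Finset.sum_neg_distrib, hX, hY]
  congr 3
  ext a
  congr 1
  ext b
  split_ifs <;> simp

end Tr
end Sl2Aux
namespace Sl2Aux
section Conj
set_option linter.unusedSectionVars false
variable {F : Type*} [Field F] [CharZero F] {ι : Type*} [Fintype ι] [DecidableEq ι]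

theorem nilp_of_weight {h f : Matrix ι ι F} (rel2 : h * f - f * h = (-2 : F) • f) :
    IsNilpotent f := by
  by_contra hcon
  have hk : ∀ k : ℕ, matAd F h (f ^ k) = (-2 * k : F) • f ^ k := by
    intro k
    induction k with
    | zero => simp [matAd_apply]
    | succ k ih =>
      rw [matAd_apply] at ih ⊢
      have e1 : h * f ^ (k+1) - f ^ (k+1) * h = (h * f ^ k - f ^ k * h) * f + f ^ k * (h * f - f * h) := by
        rw [pow_succ]; noncomm_ring
      rw [e1, ih, rel2, smul_mul_assoc, mul_smul_comm, ← pow_succ, ← add_smul]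
      congr 1; push_cast; ring
  have hinj : Function.Injective (fun k : ℕ => (-2 * k : F)) := by
    intro a b hab
    have : (-2 : F) ≠ 0 := by norm_num
    exact_mod_cast mul_left_cancel₀ this hab
  have := Module.End.eigenvectors_linearIndependent' (matAd F h) (fun k : ℕ => (-2 * k : F)) hinj
    (fun k => f ^ k) (fun k => ⟨Module.End.mem_eigenspace_iff.2 (hk k), fun h0 => hcon ⟨k, h0⟩⟩)
  have := this.finite
  exact not_finite ℕ

theorem trip_vec {e h f : Matrix ι ι F} (hnil : IsNilpotent e)
    (rel1 : h * e - e * h = (2 : F) • e)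
    (rel2 : h * f - f * h = (-2 : F) • f)
    (rel3 : e * f - f * e = h) : Trip (toLin' e) (toLin' h) (toLin' f) where
  he v := by
    have : h * e = e * h + (2:F) • e := by rw [← rel1]; abel
    simp only [toLin'_apply, mulVec_mulVec, this, add_mulVec, smul_mulVec]
  hg v := by
    have : h * f = f * h - (2:F) • f := by rw [eq_sub_iff_add_eq, ← sub_eq_zero]; rw [neg_smul] at rel2; rw [← sub_eq_zero] at rel2; rw [← rel2]; abel
    simp only [toLin'_apply, mulVec_mulVec, this, sub_mulVec, smul_mulVec]
  eg v := by
    have : e * f = f * e + h := by rw [← rel3]; abel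
    simp only [toLin'_apply, mulVec_mulVec, this, add_mulVec]
  nE := by
    obtain ⟨N, hN⟩ := hnil
    exact ⟨N, fun v => by rw [← toLin'_pow, hN]; simp⟩
  nG := by
    obtain ⟨N, hN⟩ := nilp_of_weight rel2
    exact ⟨N, fun v => by rw [← toLin'_pow, hN]; simp⟩

theorem matAd_nilp {e : Matrix ι ι F} (he : IsNilpotent e) :
    ∃ N : ℕ, ∀ v, ((matAd F e) ^ N) v = 0 := by
  have : IsNilpotent (matAd F e) := by
    unfold matAd
    apply Commute.isNilpotent_sub
    · exact LinearMap.commute_mulLeft_right e e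
    · exact (LinearMap.isNilpotent_mulLeft_iff F e).2 he
    · exact (LinearMap.isNilpotent_mulRight_iff F e).2 he
  obtain ⟨N, hN⟩ := this
  exact ⟨N, fun v => by rw [hN]; simp⟩

theorem trip_ad {e h f : Matrix ι ι F} (hnil : IsNilpotent e)
    (rel1 : h * e - e * h = (2 : F) • e)
    (rel2 : h * f - f * h = (-2 : F) • f)
    (rel3 : e * f - f * e = h) : Trip (matAd F e) (matAd F h) (matAd F f) where
  he v := by
    have : (2:F) • (e * v - v * e) = (h * e - e * h) * v - v * (h * e - e * h) := by
      rw [rel1]; simp [smul_sub]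
    simp only [matAd_apply, this]; noncomm_ring
  hg v := by
    have : -((2:F) • (f * v - v * f)) = (h * f - f * h) * v - v * (h * f - f * h) := by
      rw [rel2]; simp [smul_sub]
      abel
    simp only [matAd_apply, sub_eq_add_neg _ ((2:F) • _), this]; noncomm_ring
  eg v := by
    simp only [matAd_apply, ← rel3]; noncomm_ring
  nE := matAd_nilp hnil
  nG := matAd_nilp (nilp_of_weight rel2)

theorem exists_diag {A : Matrix ι ι F} (h : ⨆ n : ℤ, Module.End.eigenspace (toLin' A) (n:F) = ⊤) :
    ∃ (P : Matrix ι ι F) (w : ι → ℤ), IsUnit P ∧ A * P = P * diagonal (fun a => (w a : F)) := by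
  set s : Set (ι → F) := {v | ∃ n : ℤ, A *ᵥ v = (n:F) • v} with hs
  have hspan : ⊤ ≤ Submodule.span F s := by
    rw [← h]
    refine iSup_le fun n v hv => Submodule.subset_span ⟨n, ?_⟩
    simpa using Module.End.mem_eigenspace_iff.1 hv
  set b0 := Module.Basis.ofSpan hspan
  have hb0 : ∀ i, b0 i ∈ s := fun i => Module.Basis.ofSpan_subset hspan ⟨i, rfl⟩
  set b := b0.reindex (b0.indexEquiv (Pi.basisFun F ι)) with hb
  have hbs : ∀ i, b i ∈ s := fun i => by rw [hb, Module.Basis.reindex_apply]; exact hb0 _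
  choose w hw using hbs
  refine ⟨Matrix.of fun i j => b j i, w, ?_, ?_⟩
  · rw [← Matrix.linearIndependent_cols_iff_isUnit]
    exact b.linearIndependent
  · ext i j
    have := congrFun (hw j) i
    rw [mul_diagonal]
    simp only [mul_apply, of_apply]
    simp only [mulVec, dotProduct, Pi.smul_apply, smul_eq_mul] at this
    rw [this, mul_comm]

end Conj
end Sl2Aux
namespace Sl2Aux
section Core
set_option linter.unusedSectionVars false
variable {F : Type*} [Field F] [CharZero F] {m n : Type*} [Fintype m] [DecidableEq m]
  [Fintype n] [DecidableEq n]

theorem blk1 {h0 : Matrix m m F} {h1 : Matrix n n F}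
    (h : ⨆ k : ℤ, Module.End.eigenspace (toLin' (fromBlocks h0 0 0 h1)) (k:F) = ⊤) :
    ⨆ k : ℤ, Module.End.eigenspace (toLin' h0) (k:F) = ⊤ := by
  have hs : Function.Surjective (LinearMap.funLeft F F (Sum.inl : m → m ⊕ n)) :=
    LinearMap.funLeft_surjective_of_injective F F _ Sum.inl_injective
  rw [eq_top_iff, ← LinearMap.range_eq_top.2 hs, LinearMap.range_eq_map, ← h, Submodule.map_iSup]
  refine iSup_mono fun k => ?_
  rintro _ ⟨v, hv, rfl⟩
  have := Module.End.mem_eigenspace_iff.1 hv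
  rw [Module.End.mem_eigenspace_iff]
  ext i
  have := congrFun this (Sum.inl i)
  simpa [toLin'_apply, mulVec, dotProduct, LinearMap.funLeft_apply] using this

theorem blk2 {h0 : Matrix m m F} {h1 : Matrix n n F}
    (h : ⨆ k : ℤ, Module.End.eigenspace (toLin' (fromBlocks h0 0 0 h1)) (k:F) = ⊤) :
    ⨆ k : ℤ, Module.End.eigenspace (toLin' h1) (k:F) = ⊤ := by
  have hs : Function.Surjective (LinearMap.funLeft F F (Sum.inr : n → m ⊕ n)) :=
    LinearMap.funLeft_surjective_of_injective F F _ Sum.inr_injective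
  rw [eq_top_iff, ← LinearMap.range_eq_top.2 hs, LinearMap.range_eq_map, ← h, Submodule.map_iSup]
  refine iSup_mono fun k => ?_
  rintro _ ⟨v, hv, rfl⟩
  have := Module.End.mem_eigenspace_iff.1 hv
  rw [Module.End.mem_eigenspace_iff]
  ext i
  have := congrFun this (Sum.inr i)
  simpa [toLin'_apply, mulVec, dotProduct, LinearMap.funLeft_apply] using this

/-- the grading sign -/
def sg : m ⊕ n → ℤ := Sum.elim (fun _ => 1) (fun _ => -1)

theorem sg_pm (a : m ⊕ n) : sg a = 1 ∨ sg a = -1 := by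
  rcases a with a | a <;> simp [sg]

theorem odd_iff (x : Matrix (m ⊕ n) (m ⊕ n) F) :
    (∀ a b, x a b ≠ 0 → sg a * sg b = -1) ↔ ∃ u v, x = fromBlocks 0 u v 0 := by
  constructor
  · intro h
    refine ⟨x.toBlocks₁₂, x.toBlocks₂₁, ?_⟩
    ext a b
    by_cases h0 : x a b = 0
    · rcases a with a | a <;> rcases b with b | b <;> simp [h0, toBlocks₁₂, toBlocks₂₁]
    · have := h a b h0
      rcases a with a | a <;> rcases b with b | b <;> simp [sg, toBlocks₁₂, toBlocks₂₁] at this ⊢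
  · rintro ⟨u, v, rfl⟩ a b h
    rcases a with a | a <;> rcases b with b | b <;> simp [sg] at h ⊢

theorem odd_conj {x : Matrix (m ⊕ n) (m ⊕ n) F} (hx : ∀ a b, x a b ≠ 0 → sg a * sg b = -1)
    (P0 Q0 : Matrix m m F) (P1 Q1 : Matrix n n F) :
    ∀ a b, (fromBlocks P0 0 0 P1 * x * fromBlocks Q0 0 0 Q1) a b ≠ 0 → sg a * sg b = -1 := by
  rw [odd_iff] at hx ⊢
  obtain ⟨u, v, rfl⟩ := hx
  exact ⟨P0 * u * Q1, P1 * v * Q0, by simp [fromBlocks_multiply]⟩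

theorem mem_anti {p q : ℕ} (x : Matrix (Fin p ⊕ Fin q) (Fin p ⊕ Fin q) F) :
    x ∈ antiDiagBlock F p q ↔ ∀ a b, x a b ≠ 0 → sg a * sg b = -1 := by
  constructor
  · rintro ⟨h1, h2⟩ a b h
    rcases a with a | a <;> rcases b with b | b
    · exact absurd (h1 a b) h
    · simp [sg]
    · simp [sg]
    · exact absurd (h2 a b) h
  · intro h
    constructor
    · intro i j
      by_contra h0
      have := h _ _ h0
      simp [sg] at this
    · intro i j
      by_contra h0
      have := h _ _ h0
      simp [sg] at this

/-- conjugation as a linear equivalence -/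
def cj {ι : Type*} [Fintype ι] [DecidableEq ι] (P Q : Matrix ι ι F) (h1 : P * Q = 1) (h2 : Q * P = 1) :
    Matrix ι ι F ≃ₗ[F] Matrix ι ι F where
  toFun x := Q * x * P
  invFun x := P * x * Q
  map_add' x y := by simp [mul_add, add_mul]
  map_smul' c x := by simp
  left_inv x := by
    show P * (Q * x * P) * Q = x
    calc P * (Q * x * P) * Q = (P * Q) * x * (P * Q) := by noncomm_ring
      _ = x := by simp [h1]
  right_inv x := by
    show Q * (P * x * Q) * P = x
    calc Q * (P * x * Q) * P = (Q * P) * x * (Q * P) := by noncomm_ring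
      _ = x := by simp [h2]

theorem core (p : ℕ)
    (e h f : Matrix (Fin p ⊕ Fin (p+1)) (Fin p ⊕ Fin (p+1)) F)
    (he : ∀ a b, e a b ≠ 0 → sg a * sg b = -1)
    (hnil : IsNilpotent e)
    (hh : ∀ i j, h (Sum.inl i) (Sum.inr j) = 0)
    (hh' : ∀ i j, h (Sum.inr i) (Sum.inl j) = 0)
    (hf : ∀ a b, f a b ≠ 0 → sg a * sg b = -1)
    (rel1 : h * e - e * h = (2 : F) • e)
    (rel2 : h * f - f * h = (-2 : F) • f)
    (rel3 : e * f - f * e = h)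
    (S0 : Submodule F (Matrix (Fin p ⊕ Fin (p+1)) (Fin p ⊕ Fin (p+1)) F))
    (hS0 : S0 = antiDiagBlock F p (p+1) ⊓ LinearMap.ker (matAd F f))
    (T : Module.End F ↥S0)
    (hT : ∀ m : ↥S0,
      (T m : Matrix (Fin p ⊕ Fin (p+1)) (Fin p ⊕ Fin (p+1)) F)
        = (2 : F) • (m : Matrix (Fin p ⊕ Fin (p+1)) (Fin p ⊕ Fin (p+1)) F)
          - (h * (m : Matrix (Fin p ⊕ Fin (p+1)) (Fin p ⊕ Fin (p+1)) F)
            - (m : Matrix (Fin p ⊕ Fin (p+1)) (Fin p ⊕ Fin (p+1)) F) * h))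
    (htr : LinearMap.trace F _ T = ((2 * p * (p + 1) : ℕ) : F)) :
    ∃ (P Q : Matrix (Fin p ⊕ Fin (p+1)) (Fin p ⊕ Fin (p+1)) F) (w : Fin p ⊕ Fin (p+1) → ℤ),
      P * Q = 1 ∧ Q * P = 1 ∧ h = P * diagonal (fun a => (w a : F)) * Q ∧
      Function.Injective w ∧ ∀ a, Even (w a) := by
  classical
  have hblk : h = fromBlocks h.toBlocks₁₁ 0 0 h.toBlocks₂₂ := by
    ext a b
    rcases a with a | a <;> rcases b with b | b <;> simp [hh, hh', toBlocks₁₁, toBlocks₂₂]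
  have hV := (trip_vec hnil rel1 rel2 rel3).iSup_top
  rw [hblk] at hV
  obtain ⟨P0, w0, hP0, hw0⟩ := exists_diag (blk1 hV)
  obtain ⟨P1, w1, hP1, hw1⟩ := exists_diag (blk2 hV)
  have d0 := (Matrix.isUnit_iff_isUnit_det _).1 hP0
  have d1 := (Matrix.isUnit_iff_isUnit_det _).1 hP1
  set P := fromBlocks P0 0 0 P1 with hP
  set Q := fromBlocks P0⁻¹ 0 0 P1⁻¹ with hQ
  set w : Fin p ⊕ Fin (p+1) → ℤ := Sum.elim w0 w1 with hw
  have hPQ : P * Q = 1 := by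
    simp [hP, hQ, fromBlocks_multiply, Matrix.mul_nonsing_inv _ d0, Matrix.mul_nonsing_inv _ d1, fromBlocks_one]
  have hQP : Q * P = 1 := by
    simp [hP, hQ, fromBlocks_multiply, Matrix.nonsing_inv_mul _ d0, Matrix.nonsing_inv_mul _ d1, fromBlocks_one]
  set D := diagonal (fun a => (w a : F)) with hD
  have hDb : D = fromBlocks (diagonal fun a => (w0 a : F)) 0 0 (diagonal fun a => (w1 a : F)) := by
    rw [fromBlocks_diagonal, hD]
    congr 1
    ext a
    rcases a with a | a <;> simp [hw]
  have hhP : h * P = P * D := by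
    rw [hDb, hblk, hP, fromBlocks_multiply, fromBlocks_multiply]
    simp [hw0, hw1]
  have hhD : h = P * D * Q := by rw [← hhP, mul_assoc, hPQ, mul_one]
  have hQhP : Q * h * P = D := by rw [mul_assoc, hhP, ← mul_assoc, hQP, one_mul]
  set Φ := cj P Q hPQ hQP with hΦ
  have Φm : ∀ x y, Φ (x * y) = Φ x * Φ y := by
    intro x y
    show Q * (x * y) * P = (Q * x * P) * (Q * y * P)
    calc Q * (x * y) * P = Q * x * 1 * y * P := by noncomm_ring
      _ = _ := by rw [← hPQ]; noncomm_ring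
  have Φad : ∀ x y, Φ (matAd F x y) = matAd F (Φ x) (Φ y) := by
    intro x y
    simp only [matAd_apply, map_sub, Φm]
  have Φh : Φ h = D := hQhP
  have r1 : D * Φ e - Φ e * D = (2:F) • Φ e := by
    rw [← Φh, ← Φm, ← Φm, ← map_sub, rel1, map_smul]
  have r2 : D * Φ f - Φ f * D = (-2:F) • Φ f := by
    rw [← Φh, ← Φm, ← Φm, ← map_sub, rel2, map_smul]
  have r3 : Φ e * Φ f - Φ f * Φ e = D := by
    rw [← Φh, ← Φm, ← Φm, ← map_sub, rel3]
  have nil' : IsNilpotent (Φ e) := by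
    obtain ⟨N, hN⟩ := hnil
    refine ⟨N + 1, ?_⟩
    have : ∀ k : ℕ, (Φ e) ^ (k+1) = Φ (e ^ (k+1)) := by
      intro k
      induction k with
      | zero => simp
      | succ k ih => rw [pow_succ, ih, ← Φm, ← pow_succ]
    rw [this, pow_succ, hN]; simp
  have oe : ∀ a b, Φ e a b ≠ 0 → sg a * sg b = -1 := odd_conj he _ _ _ _
  have of' : ∀ a b, Φ f a b ≠ 0 → sg a * sg b = -1 := odd_conj hf _ _ _ _
  have we : ∀ a b, Φ e a b ≠ 0 → w a - w b = 2 :=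
    weight_of (n := 2) (by rw [matAd_apply]; exact_mod_cast r1)
  have wf : ∀ a b, Φ f a b ≠ 0 → w a - w b = -2 :=
    weight_of (n := -2) (by rw [matAd_apply]; exact_mod_cast r2)
  have tv := trip_vec nil' r1 r2 r3
  have ta := trip_ad nil' r1 r2 r3
  set Ψ : S0 ≃ₗ[F] S0.map Φ.toLinearMap := Φ.submoduleMap S0 with hΨ
  have tf := trace_formula w sg sg_pm (Φ e) (Φ f) ta of' wf
    (S0.map Φ.toLinearMap) (by
      intro x
      have : x ∈ S0.map Φ.toLinearMap ↔ Φ.symm x ∈ S0 := by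
        rw [Submodule.mem_map_equiv]
      rw [this, hS0, Submodule.mem_inf, mem_anti, LinearMap.mem_ker]
      refine and_congr ?_ ?_
      · constructor
        · intro hx
          have := odd_conj hx P0⁻¹ P0 P1⁻¹ P1
          have h2 : fromBlocks P0⁻¹ 0 0 P1⁻¹ * Φ.symm x * fromBlocks P0 0 0 P1 = x :=
            Φ.apply_symm_apply x
          rwa [h2] at this
        · intro hx
          exact odd_conj hx _ _ _ _
      · rw [← Φ.map_eq_zero_iff, Φad, Φ.apply_symm_apply])
    (Ψ.conj T) (by
      intro x
      obtain ⟨y, rfl⟩ := Ψ.surjective x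
      have e1 : (Ψ.conj T) (Ψ y) = Ψ (T y) := by simp [LinearEquiv.conj_apply]
      have e2 : ∀ z : S0, ((Ψ z : S0.map Φ.toLinearMap) : Matrix _ _ F) = Φ z :=
        fun z => rfl
      rw [e1, e2, e2, hT, map_sub, map_smul, ← matAd_apply, Φad, Φh])
  rw [LinearMap.trace_conj', htr] at tf
  have tf' := (Int.cast_injective (α := F)) ((Int.cast_natCast _).trans tf)
  have hcount : ((2 * p * (p + 1) : ℕ) : ℤ) = ∑ a : Fin p ⊕ Fin (p+1), ∑ b : Fin p ⊕ Fin (p+1),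
      if (sg a * sg b : ℤ) = -1 then (1:ℤ) else 0 := by
    simp [Fintype.sum_sum_type, sg]
    ring
  obtain ⟨c1, c2⟩ := comb w sg sg_pm (by simp [Fintype.sum_sum_type, sg]) (tf'.symm.trans hcount)
  have hinj := comb_inj w sg sg_pm c1 c2
  refine ⟨P, Q, w, hPQ, hQP, hhD, hinj, ?_⟩
  have sgn : ∀ a b : Fin p ⊕ Fin (p+1), (sg a * sg b : ℤ) = -1 → (sg a : ℤ) = - sg b := by
    intro a b hab
    rcases a with a | a <;> rcases b with b | b <;> simp [sg] at hab ⊢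
  have hDs : ∀ a, toLin' D (Pi.single a 1) = ((w a : ℤ) : F) • Pi.single a (1:F) := by
    intro a
    ext b
    simp [hD, toLin'_apply, diagonal_apply, Pi.single_apply]
  refine comb_even w sg sg_pm hinj c2 ?_ ?_ ?_ ?_
  · intro a ha
    have : toLin' (Φ e) (Pi.single a 1) ≠ 0 := by
      intro h0
      have := tv.injE ha _ (hDs a) h0
      simpa using congrFun this a
    obtain ⟨c, hc⟩ := Function.ne_iff.1 this
    have hc' : Φ e c a ≠ 0 := by simpa [toLin'_apply] using hc
    exact ⟨c, by have := we c a hc'; omega, sgn _ _ (oe c a hc')⟩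
  · intro a ha
    have : toLin' (Φ f) (Pi.single a 1) ≠ 0 := by
      intro h0
      have := tv.injG ha _ (hDs a) h0
      simpa using congrFun this a
    obtain ⟨c, hc⟩ := Function.ne_iff.1 this
    have hc' : Φ f c a ≠ 0 := by simpa [toLin'_apply] using hc
    exact ⟨c, by have := wf c a hc'; omega, sgn _ _ (of' c a hc')⟩
  · have : trace D = 0 := by rw [← r3, trace_sub, trace_mul_comm, sub_self]
    rw [hD, trace_diagonal] at this
    exact_mod_cast this
  · simp

end Core
end Sl2Aux
namespace Sl2Aux
section Irr
set_option linter.unusedSectionVars false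
variable {F : Type*} [Field F] [CharZero F] {M : Type*} [AddCommGroup M] [Module F M]
  [FiniteDimensional F M] {E H G : Module.End F M}

theorem Trip.iSup_top' (t : Trip E H G) : ⨆ μ : F, H.eigenspace μ = ⊤ := by
  rw [eq_top_iff, ← t.iSup_top]
  exact iSup_le fun n => le_iSup (fun μ : F => H.eigenspace μ) (n:F)

theorem Trip.decomp (t : Trip E H G) (K : Submodule F M) (hK : ∀ v ∈ K, H v ∈ K) :
    K = ⨆ μ : F, K ⊓ H.eigenspace μ := by
  have := Submodule.inf_iSup_genEigenspace (p := K) (f := H) hK 1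
  rw [← this]
  have h2 := t.iSup_top'
  have h3 : ⨆ μ : F, (H.genEigenspace μ) 1 = ⊤ := h2
  rw [h3, inf_top_eq]

theorem Trip.hw_even (t : Trip E H G)
    (hev : ∀ (n : ℤ) (v : M), v ≠ 0 → H v = (n:F) • v → Even n)
    {u : M} {μ : F} (hu : u ≠ 0) (hE : E u = 0) (hH : H u = μ • u) :
    ∃ k : ℕ, μ = ((2 * k : ℕ) : F) := by
  obtain ⟨N, hN⟩ := t.nG
  obtain ⟨h1, h2 | ⟨n, _, hn⟩⟩ := t.gen_ker N hE (hN u) (eig_gen hH)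
  · exact absurd h2 hu
  · have := hev n u hu (by rw [hH, hn]; simp)
    have h3 : Even n := by exact_mod_cast this
    obtain ⟨k, hk⟩ := h3
    exact ⟨k, by rw [hn, hk]; congr 1; omega⟩

theorem Trip.exists_hw (t : Trip E H G)
    (hev : ∀ (n : ℤ) (v : M), v ≠ 0 → H v = (n:F) • v → Even n)
    (K : Submodule F M) (hK : ∀ v ∈ K, H v ∈ K) (hKE : ∀ v ∈ K, E v = 0) (hne : K ≠ ⊥) :
    ∃ u ∈ K, u ≠ 0 ∧ ∃ k : ℕ, H u = ((2 * k : ℕ) : F) • u := by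
  by_contra hcon
  apply hne
  rw [t.decomp K hK]
  refine iSup_eq_bot.2 fun μ => ?_
  rw [eq_bot_iff]
  rintro u ⟨h1, h2⟩
  have h3 := Module.End.mem_eigenspace_iff.1 h2
  by_contra h0
  have h0 : u ≠ 0 := fun h => h0 (by simp [h])
  obtain ⟨k, hk⟩ := t.hw_even hev h0 (hKE u h1) h3
  exact hcon ⟨u, h1, h0, k, by rw [h3, hk]⟩

theorem Trip.to_zero (t : Trip E H G) {u : M} {k : ℕ} (hE : E u = 0)
    (hH : H u = ((2 * k : ℕ) : F) • u) :
    H ((G ^ k) u) = 0 ∧ ∃ c : F, c ≠ 0 ∧ (E ^ k) ((G ^ k) u) = c • u := by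
  constructor
  · rw [t.wG hH k]; push_cast; simp
  · apply t.EG_const hE hH
    intro i hi h
    have : 2 * k = i := by exact_mod_cast h
    omega

theorem Trip.from_zero (t : Trip E H G) (k : ℕ) : ∀ v : M, H v = ((2 * k : ℤ) : F) • v →
    ∃ z, H z = 0 ∧ (E ^ k) z = v := by
  induction k with
  | zero => intro v hv; exact ⟨v, by simpa using hv, by simp⟩
  | succ k ih =>
    intro v hv
    obtain ⟨x, hx, rfl⟩ := t.surjE (n := 2 * ((k+1 : ℕ):ℤ)) (by push_cast; omega) v hv
    obtain ⟨z, hz, rfl⟩ := ih x (by rw [hx]; congr 2; push_cast; ring)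
    exact ⟨z, hz, by rw [pow_succ', Module.End.mul_apply]⟩

theorem Trip.from_zero' (t : Trip E H G) (k : ℕ) (v : M) (hv : H v = ((-(2 * k) : ℤ) : F) • v) :
    ∃ z, H z = 0 ∧ (G ^ k) z = v := by
  obtain ⟨z, hz, h⟩ := t.symm.from_zero k v (by
    rw [LinearMap.neg_apply, hv, ← neg_smul]; congr 1; push_cast; ring)
  exact ⟨z, by simpa using hz, h⟩

theorem pow_mem {W : Submodule F M} {A : Module.End F M} (hA : ∀ w ∈ W, A w ∈ W) (k : ℕ) :
    ∀ v ∈ W, (A ^ k) v ∈ W := by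
  induction k with
  | zero => intro v hv; simpa using hv
  | succ k ih => intro v hv; rw [pow_succ', Module.End.mul_apply]; exact hA _ (ih v hv)

theorem Trip.exists_ker (t : Trip E H G) {W : Submodule F M} (hW : ∀ w ∈ W, E w ∈ W)
    (hne : W ≠ ⊥) : W ⊓ LinearMap.ker E ≠ ⊥ := by
  obtain ⟨v, hv, hv0⟩ := Submodule.exists_mem_ne_zero_of_ne_bot hne
  obtain ⟨N, hN⟩ := t.nE
  have key : ∀ N : ℕ, ∀ v ∈ W, v ≠ 0 → (E ^ N) v = 0 → ∃ u ∈ W, u ≠ 0 ∧ E u = 0 := by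
    intro N
    induction N with
    | zero => intro v _ h1 h2; exact absurd (by simpa using h2) h1
    | succ N ih =>
      intro v h0 h1 h2
      by_cases h3 : E v = 0
      · exact ⟨v, h0, h1, h3⟩
      · exact ih (E v) (hW v h0) h3 (by rwa [pow_succ, Module.End.mul_apply] at h2)
  obtain ⟨u, h1, h2, h3⟩ := key N v hv hv0 (hN v)
  intro hb
  have : u ∈ W ⊓ LinearMap.ker E := ⟨h1, h3⟩
  rw [hb] at this
  exact h2 (by simpa using this)

theorem Trip.ker_inv (t : Trip E H G) {v : M} (hv : E v = 0) : E (H v) = 0 := by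
  have := t.he v
  rw [hv] at this
  simpa using this.symm

theorem Trip.irr (t : Trip E H G)
    (hev : ∀ (n : ℤ) (v : M), v ≠ 0 → H v = (n:F) • v → Even n)
    (hk : ∀ u v : M, H u = 0 → H v = 0 → u ≠ 0 → ∃ c : F, v = c • u)
    (W : Submodule F M) (hWE : ∀ w ∈ W, E w ∈ W) (hWH : ∀ w ∈ W, H w ∈ W)
    (hWG : ∀ w ∈ W, G w ∈ W) : W = ⊥ ∨ W = ⊤ := by
  by_cases hne : W = ⊥
  · exact Or.inl hne
  right
  obtain ⟨u, ⟨hu, huE⟩, hu0, k, hH⟩ := t.exists_hw hev (W ⊓ LinearMap.ker E)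
    (fun v hv => ⟨hWH v hv.1, t.ker_inv hv.2⟩) (fun v hv => hv.2) (t.exists_ker hWE hne)
  obtain ⟨hz, c, hc, hcz⟩ := t.to_zero huE hH
  have hz0 : (G ^ k) u ≠ 0 := by
    intro h
    rw [h, map_zero] at hcz
    exact smul_ne_zero hc hu0 hcz.symm
  have hker : ∀ v, H v = 0 → v ∈ W := by
    intro v hv
    obtain ⟨c, rfl⟩ := hk _ v hz hv hz0
    exact W.smul_mem _ (pow_mem hWG k u hu)
  rw [eq_top_iff, ← t.iSup_top]
  refine iSup_le fun n v hv => ?_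
  have hv := Module.End.mem_eigenspace_iff.1 hv
  by_cases hv0 : v = 0
  · rw [hv0]; exact W.zero_mem
  obtain ⟨m, hm⟩ := hev n v hv0 hv
  obtain ⟨j, rfl | rfl⟩ := m.eq_nat_or_neg
  · obtain ⟨z, hz, rfl⟩ := t.from_zero j v (by rw [hv, hm]; congr 2; ring)
    exact pow_mem hWE j z (hker z hz)
  · obtain ⟨z, hz, rfl⟩ := t.from_zero' j v (by rw [hv, hm]; congr 2; ring)
    exact pow_mem hWG j z (hker z hz)

theorem Trip.ker_line [Nontrivial M] (t : Trip E H G)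
    (hev : ∀ (n : ℤ) (v : M), v ≠ 0 → H v = (n:F) • v → Even n)
    (hk : ∀ u v : M, H u = 0 → H v = 0 → u ≠ 0 → ∃ c : F, v = c • u) :
    ∃ u0 : M, u0 ≠ 0 ∧ LinearMap.ker E = Submodule.span F {u0} := by
  have hkne : LinearMap.ker E ≠ ⊥ := by
    have := t.exists_ker (W := ⊤) (by simp) (by simp)
    rwa [top_inf_eq] at this
  obtain ⟨u0, hu0E, hu0, k0, hH0⟩ := t.exists_hw hev (LinearMap.ker E)
    (fun v hv => t.ker_inv hv) (fun v hv => hv) hkne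
  refine ⟨u0, hu0, le_antisymm ?_ ?_⟩
  swap
  · rw [Submodule.span_le]; simpa using hu0E
  rw [t.decomp (LinearMap.ker E) (fun v hv => t.ker_inv hv)]
  refine iSup_le fun μ => ?_
  rintro u ⟨huE, huH⟩
  have huE : E u = 0 := huE
  have huH := Module.End.mem_eigenspace_iff.1 huH
  by_cases hu : u = 0
  · rw [hu]; exact Submodule.zero_mem _
  obtain ⟨k, hμ⟩ := t.hw_even hev hu huE huH
  rw [hμ] at huH
  obtain ⟨hz, c, hc, hcz⟩ := t.to_zero huE huH
  obtain ⟨hz0, c0, hc0, hcz0⟩ := t.to_zero (show E u0 = 0 from hu0E) hH0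
  set z := (G ^ k) u with hzdef
  set z0 := (G ^ k0) u0 with hz0def
  have hz0ne : z0 ≠ 0 := by
    intro h; rw [h, map_zero] at hcz0; exact smul_ne_zero hc0 hu0 hcz0.symm
  have hzne : z ≠ 0 := by
    intro h; rw [h, map_zero] at hcz; exact smul_ne_zero hc hu hcz.symm
  obtain ⟨a, ha⟩ := hk z0 z hz0 hz hz0ne
  have ha0 : a ≠ 0 := by rintro rfl; exact hzne (by simpa using ha)
  have mono : ∀ (i j : ℕ) (x : M), i < j → E ((E ^ i) x) = 0 → (E ^ j) x = 0 := by
    intro i j x hij h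
    obtain ⟨d, rfl⟩ := Nat.exists_eq_add_of_lt hij
    rw [show i + d + 1 = d + (i + 1) by ring, pow_add, Module.End.mul_apply, pow_succ',
      Module.End.mul_apply, h, map_zero]
  have hkk : k = k0 := by
    rcases lt_trichotomy k k0 with h | h | h
    · exfalso
      have h1 : (E ^ k0) z = 0 := mono k k0 z h (by rw [hcz, map_smul, huE, smul_zero])
      rw [ha, map_smul, hcz0] at h1
      exact smul_ne_zero ha0 (smul_ne_zero hc0 hu0) h1
    · exact h
    · exfalso
      have h1 : (E ^ k) z0 = 0 := mono k0 k z0 h (by rw [hcz0, map_smul, show E u0 = 0 from hu0E, smul_zero])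
      have h2 : (E ^ k) z = 0 := by rw [ha, map_smul, h1, smul_zero]
      rw [hcz] at h2
      exact smul_ne_zero hc hu h2
  rw [Submodule.mem_span_singleton]
  refine ⟨c⁻¹ * (a * c0), ?_⟩
  have : c • u = (a * c0) • u0 := by
    rw [← hcz, ha, hkk, map_smul, hcz0, smul_smul]
  rw [mul_smul, ← this, smul_smul, inv_mul_cancel₀ hc, one_smul]

theorem finrank_ker_pow {u0 : M} (hker : LinearMap.ker E = Submodule.span F {u0}) (k : ℕ) :
    Module.finrank F (LinearMap.ker (E ^ k)) ≤ k := by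
  induction k with
  | zero => simp [Module.End.one_eq_id]
  | succ k ih =>
    set K := LinearMap.ker (E ^ (k+1))
    have h1 := LinearMap.finrank_range_add_finrank_ker ((E ^ k).domRestrict K)
    have h2 : Module.finrank F (LinearMap.range ((E ^ k).domRestrict K)) ≤ 1 := by
      refine le_trans (Submodule.finrank_mono (t := LinearMap.ker E) ?_) ?_
      · rintro _ ⟨⟨v, hv⟩, rfl⟩
        have : (E ^ (k+1)) v = 0 := hv
        rw [pow_succ', Module.End.mul_apply] at this
        exact this
      · rw [hker]; exact (finrank_span_le_card _).trans (by simp)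
    have h3 : Module.finrank F (LinearMap.ker ((E ^ k).domRestrict K))
        ≤ Module.finrank F (LinearMap.ker (E ^ k)) := by
      have : ∀ x : LinearMap.ker ((E ^ k).domRestrict K), K.subtype x.1 ∈ LinearMap.ker (E ^ k) := by
        rintro ⟨x, hx⟩; exact hx
      refine LinearMap.finrank_le_finrank_of_injective (f := LinearMap.codRestrict _
        (K.subtype ∘ₗ (LinearMap.ker ((E ^ k).domRestrict K)).subtype) this) ?_
      intro x y hxy
      have := congrArg Subtype.val hxy
      exact Subtype.ext (Subtype.ext this)
    omega

end Irr
end Sl2Aux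
namespace Sl2Aux
section Trans
set_option linter.unusedSectionVars false
variable {F : Type*} [Field F] [CharZero F] {m n : Type*} [Fintype m] [DecidableEq m]
  [Fintype n] [DecidableEq n]

theorem pow_sg {e : Matrix (m ⊕ n) (m ⊕ n) F} (he : ∀ a b, e a b ≠ 0 → sg a * sg b = -1) (k : ℕ) :
    ∀ a b, (e ^ k) a b ≠ 0 → sg a * sg b = (-1) ^ k := by
  induction k with
  | zero =>
    intro a b h
    have : a = b := by
      by_contra hab
      exact h (by simp [Matrix.one_apply, hab])
    subst this
    rcases sg_pm a with h | h <;> simp [h]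
  | succ k ih =>
    intro a b h
    rw [pow_succ, mul_apply] at h
    obtain ⟨c, _, hc⟩ := Finset.exists_ne_zero_of_sum_ne_zero h
    have h1 := ih a c (left_ne_zero_of_mul hc)
    have h2 := he c b (right_ne_zero_of_mul hc)
    have h3 : (sg c * sg c : ℤ) = 1 := by rcases sg_pm c with h | h <;> simp [h]
    calc sg a * sg b = (sg a * sg c) * (sg c * sg b) * 1 := by
          rw [mul_one, show sg a * sg c * (sg c * sg b) = sg a * sg b * (sg c * sg c) by ring, h3, mul_one]
      _ = (-1) ^ (k+1) := by rw [h1, h2, pow_succ, mul_one]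

theorem exists_form (e : Matrix (m ⊕ n) (m ⊕ n) F) (he : ∀ a b, e a b ≠ 0 → sg a * sg b = -1)
    (p : ℕ) (h1 : e ^ (2 * p) ≠ 0) (h2 : e ^ (2 * p + 1) = 0) (u0 : m ⊕ n → F)
    (hker : LinearMap.ker (toLin' e) = Submodule.span F {u0})
    (hex : ∀ W : Submodule F (m ⊕ n → F), (∀ w ∈ W, toLin' e w ∈ W) → W ≠ ⊥ →
      W ⊓ LinearMap.ker (toLin' e) ≠ ⊥) :
    ∃ (a : Matrix m m F) (b : Matrix n n F), IsUnit (fromBlocks a 0 0 b) ∧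
      fromBlocks a 0 0 b * e = eᵀ * fromBlocks a 0 0 b := by
  obtain ⟨i0, j0, hij⟩ : ∃ i0 j0, (e ^ (2 * p)) i0 j0 ≠ 0 := by
    by_contra hcon
    push Not at hcon
    exact h1 (by ext i j; simpa using hcon i j)
  set B : Matrix (m ⊕ n) (m ⊕ n) F := Matrix.of fun a b =>
    ∑ k ∈ Finset.range (2 * p + 1), (e ^ k) i0 a * (e ^ (2 * p - k)) i0 b with hB
  have hBe : B * e = eᵀ * B := by
    ext a b
    set g : ℕ → F := fun k => (e ^ k) i0 a * (e ^ (2 * p + 1 - k)) i0 b with hg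
    have l1 : (B * e) a b = ∑ k ∈ Finset.range (2 * p + 1), g k := by
      simp only [hB, mul_apply, of_apply, Finset.sum_mul]
      rw [Finset.sum_comm]
      refine Finset.sum_congr rfl fun k hk => ?_
      have hk : k ≤ 2 * p := by simpa [Nat.lt_succ_iff] using hk
      rw [hg]
      simp only
      rw [show 2 * p + 1 - k = (2 * p - k) + 1 by omega, pow_succ, mul_apply, Finset.mul_sum]
      exact Finset.sum_congr rfl fun c _ => by ring
    have l2 : (eᵀ * B) a b = ∑ k ∈ Finset.range (2 * p + 1), g (k + 1) := by
      simp only [hB, mul_apply, of_apply, Finset.mul_sum]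
      rw [Finset.sum_comm]
      refine Finset.sum_congr rfl fun k hk => ?_
      rw [hg]
      simp only
      rw [show 2 * p + 1 - (k + 1) = 2 * p - k by omega, pow_succ, mul_apply, Finset.sum_mul]
      exact Finset.sum_congr rfl fun c _ => by rw [transpose_apply]; ring
    rw [l1, l2]
    have e1 := Finset.sum_range_succ g (2 * p + 1)
    have e2 := Finset.sum_range_succ' g (2 * p + 1)
    have g0 : g 0 = 0 := by simp [hg, h2]
    have g1 : g (2 * p + 1) = 0 := by simp [hg, h2]
    rw [g1, add_zero] at e1
    rw [g0, add_zero] at e2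
    rw [← e1, e2]
  have hBsg : ∀ a b, B a b ≠ 0 → sg a * sg b = 1 := by
    intro a b h
    simp only [hB, of_apply] at h
    obtain ⟨k, hk, hc⟩ := Finset.exists_ne_zero_of_sum_ne_zero h
    have hk : k ≤ 2 * p := by simpa [Nat.lt_succ_iff] using hk
    have h3 := pow_sg he k _ _ (left_ne_zero_of_mul hc)
    have h4 := pow_sg he _ _ _ (right_ne_zero_of_mul hc)
    have h5 : (sg i0 * sg i0 : ℤ) = 1 := by rcases sg_pm i0 with h | h <;> simp [h]
    calc sg a * sg b = sg a * sg b * (sg i0 * sg i0) := by rw [h5, mul_one]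
      _ = (sg i0 * sg a) * (sg i0 * sg b) := by ring
      _ = 1 := by
        rw [h3, h4, ← pow_add, show k + (2 * p - k) = 2 * p by omega, pow_mul]; simp
  have hblk : B = fromBlocks B.toBlocks₁₁ 0 0 B.toBlocks₂₂ := by
    ext a b
    by_cases h0 : B a b = 0
    · rcases a with a | a <;> rcases b with b | b <;> simp [h0, toBlocks₁₁, toBlocks₂₂]
    · have := hBsg a b h0
      rcases a with a | a <;> rcases b with b | b <;> simp [sg, toBlocks₁₁, toBlocks₂₂] at this ⊢
  refine ⟨B.toBlocks₁₁, B.toBlocks₂₂, ?_⟩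
  rw [← hblk]
  refine ⟨?_, hBe⟩
  rw [← Matrix.mulVec_injective_iff_isUnit]
  have hbot : LinearMap.ker (toLin' B) = ⊥ := by
    by_contra hne
    have := hex (LinearMap.ker (toLin' B)) (by
      intro w hw
      rw [LinearMap.mem_ker, toLin'_apply] at hw ⊢
      rw [toLin'_apply, mulVec_mulVec, hBe, ← mulVec_mulVec, hw, mulVec_zero]) hne
    obtain ⟨u, ⟨huB, hue⟩, hu⟩ := Submodule.exists_mem_ne_zero_of_ne_bot this
    have huB : B *ᵥ u = 0 := by simpa using huB
    have hue' : e *ᵥ u = 0 := by simpa using hue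
    have hpow : ∀ k : ℕ, 0 < k → (e ^ k) *ᵥ u = 0 := by
      intro k hk
      obtain ⟨k, rfl⟩ := Nat.exists_eq_add_of_lt hk
      rw [pow_succ, ← mulVec_mulVec, hue', mulVec_zero]
    have h3 : (B *ᵥ u) j0 = (e ^ (2 * p)) i0 j0 * u i0 := by
      have : (B *ᵥ u) j0 = ∑ k ∈ Finset.range (2 * p + 1),
          (e ^ k) i0 j0 * ((e ^ (2 * p - k)) *ᵥ u) i0 := by
        simp only [hB, mulVec, dotProduct, of_apply, Finset.sum_mul, Finset.mul_sum]
        rw [Finset.sum_comm]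
        refine Finset.sum_congr rfl fun k _ => Finset.sum_congr rfl fun c _ => by ring
      rw [this, Finset.sum_range_succ, Finset.sum_eq_zero]
      · simp
      · intro k hk
        rw [hpow _ (by have := Finset.mem_range.1 hk; omega)]
        simp
    rw [huB] at h3
    have h4 : u i0 = 0 := by
      rcases mul_eq_zero.1 h3.symm with h | h
      · exact absurd h hij
      · exact h
    rw [hker, SetLike.mem_coe, Submodule.mem_span_singleton] at hue
    obtain ⟨c, rfl⟩ := hue
    have h5 : (e ^ (2 * p)) *ᵥ (Pi.single j0 1) ∈ LinearMap.ker (toLin' e) := by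
      rw [LinearMap.mem_ker, toLin'_apply, mulVec_mulVec, ← pow_succ', h2, zero_mulVec]
    rw [hker, Submodule.mem_span_singleton] at h5
    obtain ⟨d, hd⟩ := h5
    have h6 := congrFun hd i0
    simp at h6
    rcases smul_eq_zero.1 (show c • u0 i0 = 0 from h4) with h | h
    · exact hu (by rw [h, zero_smul])
    · rw [h] at h6; simp at h6; exact hij h6.symm
  have := LinearMap.ker_eq_bot.1 hbot
  intro x y hxy
  exact this (by simpa using hxy)

end Trans
end Sl2Aux

/-- for a nilpotent `e ∈ I_{p,p+1}` extended to a graded sl₂-triple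
`{h, e, f}`, if `tr(2 − ad h)` on `I_{p,p+1}^f = I_{p,p+1} ∩ ker(ad f)` equals
`2p(p+1)`, then the graded module `F^p ⊕ F^{p+1}` is irreducible, `e` is regular
nilpotent (`e^{2p} ≠ 0`), and `eᵀ` lies in the `H_{p,p+1} = GL_p × GL_{p+1}`-orbit
of `e`. -/
theorem stmt_6 (F : Type*) [Field F] [CharZero F] (p : ℕ) (hp : 1 ≤ p)
    (x : Matrix (Fin p) (Fin (p+1)) F) (y : Matrix (Fin (p+1)) (Fin p) F)
    (e : Matrix (Fin p ⊕ Fin (p+1)) (Fin p ⊕ Fin (p+1)) F)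
    (he : e = fromBlocks 0 x y 0)
    (hnil : IsNilpotent e)
    (h f : Matrix (Fin p ⊕ Fin (p+1)) (Fin p ⊕ Fin (p+1)) F)
    (hh : ∀ i j, h (Sum.inl i) (Sum.inr j) = 0)
    (hh' : ∀ i j, h (Sum.inr i) (Sum.inl j) = 0)
    (hf : f ∈ antiDiagBlock F p (p+1))
    (rel1 : h * e - e * h = (2 : F) • e)
    (rel2 : h * f - f * h = (-2 : F) • f)
    (rel3 : e * f - f * e = h)
    (T : Module.End F ↥(antiDiagBlock F p (p+1) ⊓ LinearMap.ker (matAd F f)))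
    (hT : ∀ m : ↥(antiDiagBlock F p (p+1) ⊓ LinearMap.ker (matAd F f)),
      (T m : Matrix (Fin p ⊕ Fin (p+1)) (Fin p ⊕ Fin (p+1)) F)
        = (2 : F) • (m : Matrix (Fin p ⊕ Fin (p+1)) (Fin p ⊕ Fin (p+1)) F)
          - (h * (m : Matrix (Fin p ⊕ Fin (p+1)) (Fin p ⊕ Fin (p+1)) F)
            - (m : Matrix (Fin p ⊕ Fin (p+1)) (Fin p ⊕ Fin (p+1)) F) * h))
    (htr : LinearMap.trace F _ T = ((2 * p * (p + 1) : ℕ) : F)) :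
    (∀ W : Submodule F (Fin p ⊕ Fin (p+1) → F),
        (∀ w ∈ W, e.mulVec w ∈ W) → (∀ w ∈ W, h.mulVec w ∈ W) →
        (∀ w ∈ W, f.mulVec w ∈ W) → W = ⊥ ∨ W = ⊤)
    ∧ e ^ (2 * p) ≠ 0
    ∧ ∃ (a : Matrix (Fin p) (Fin p) F) (b : Matrix (Fin (p+1)) (Fin (p+1)) F),
        IsUnit a ∧ IsUnit b ∧
        fromBlocks a 0 0 b * e * (fromBlocks a 0 0 b)⁻¹ = fromBlocks 0 yᵀ xᵀ 0 := by
  have heo : ∀ a b, e a b ≠ 0 → Sl2Aux.sg a * Sl2Aux.sg b = -1 :=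
    (Sl2Aux.odd_iff e).2 ⟨x, y, he⟩
  have hfo := (Sl2Aux.mem_anti f).1 hf
  obtain ⟨P, Q, w, hPQ, hQP, hhD, hinj, hevw⟩ := Sl2Aux.core p e h f heo hnil hh hh' hfo rel1 rel2
    rel3 _ rfl T hT htr
  have t := Sl2Aux.trip_vec hnil rel1 rel2 rel3
  have hQinj : ∀ v, Q *ᵥ v = 0 → v = 0 := by
    intro v hv
    rw [← one_mulVec v, ← hPQ, ← mulVec_mulVec, hv, mulVec_zero]
  have hentry : ∀ (μ : F) (v : Fin p ⊕ Fin (p+1) → F), toLin' h v = μ • v →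
      ∀ a, (Q *ᵥ v) a ≠ 0 → (w a : F) = μ := by
    intro μ v hv a ha
    have h1 : diagonal (fun a => (w a : F)) *ᵥ (Q *ᵥ v) = μ • (Q *ᵥ v) := by
      rw [toLin'_apply, hhD] at hv
      rw [← mulVec_smul, ← hv, mulVec_mulVec, mulVec_mulVec, ← mul_assoc, ← mul_assoc, hQP, one_mul]
    have h2 := congrFun h1 a
    rw [mulVec_diagonal, Pi.smul_apply, smul_eq_mul] at h2
    exact mul_right_cancel₀ ha h2
  have hev : ∀ (n : ℤ) (v : Fin p ⊕ Fin (p+1) → F), v ≠ 0 → toLin' h v = (n:F) • v → Even n := by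
    intro n v hv0 hv
    obtain ⟨a, ha⟩ := Function.ne_iff.1 (fun h0 => hv0 (hQinj v h0))
    have : w a = n := by exact_mod_cast hentry n v hv a ha
    rw [← this]; exact hevw a
  have hk : ∀ u v : Fin p ⊕ Fin (p+1) → F, toLin' h u = 0 → toLin' h v = 0 → u ≠ 0 →
      ∃ c : F, v = c • u := by
    intro u v hu hv hu0
    obtain ⟨a, ha⟩ := Function.ne_iff.1 (fun h0 => hu0 (hQinj u h0))
    have ha : (Q *ᵥ u) a ≠ 0 := ha
    have hwa : w a = 0 := by exact_mod_cast hentry 0 u (by simp [hu]) a ha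
    refine ⟨(Q *ᵥ v) a / (Q *ᵥ u) a, ?_⟩
    rw [← sub_eq_zero]
    apply hQinj
    rw [mulVec_sub, mulVec_smul]
    ext b
    simp only [Pi.sub_apply, Pi.smul_apply, smul_eq_mul, Pi.zero_apply]
    by_cases hab : b = a
    · subst hab; field_simp; simp
    · have h0 : ∀ z, toLin' h z = 0 → (Q *ᵥ z) b = 0 := by
        intro z hz
        by_contra hzb
        have : w b = 0 := by exact_mod_cast hentry 0 z (by simp [hz]) b hzb
        exact hab (hinj (this.trans hwa.symm))
      rw [h0 u hu, h0 v hv]; simp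
  have : Nontrivial (Fin p ⊕ Fin (p+1) → F) :=
    Function.nontrivial (α := Fin p ⊕ Fin (p+1)) (h := ⟨Sum.inr 0⟩)
  obtain ⟨u0, hu0, hker⟩ := t.ker_line hev hk
  have hreg : e ^ (2 * p) ≠ 0 := by
    intro h0
    have h1 := Sl2Aux.finrank_ker_pow hker (2 * p)
    rw [← toLin'_pow, h0, map_zero, LinearMap.ker_zero, finrank_top] at h1
    simp at h1
    omega
  have hnil1 : e ^ (2 * p + 1) = 0 := by
    have h1 := (Matrix.isNilpotent_charpoly_sub_pow_of_isNilpotent hnil).eq_zero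
    have this := Matrix.aeval_self_charpoly e
    rw [sub_eq_zero.1 h1, map_pow, Polynomial.aeval_X] at this
    have hc : Fintype.card (Fin p ⊕ Fin (p+1)) = 2 * p + 1 := by simp; ring
    rwa [hc] at this
  refine ⟨?_, hreg, ?_⟩
  · intro W hWe hWh hWf
    exact t.irr hev hk W (by simpa using hWe) (by simpa using hWh) (by simpa using hWf)
  · obtain ⟨a, b, hu, hB⟩ := Sl2Aux.exists_form e heo p hreg hnil1 u0 hker
      (fun W hW hne => t.exists_ker hW hne)
    have hd := (Matrix.isUnit_iff_isUnit_det _).1 hu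
    have hd' := hd
    rw [det_fromBlocks_zero₂₁] at hd'
    refine ⟨a, b, (Matrix.isUnit_iff_isUnit_det _).2 (isUnit_of_mul_isUnit_left hd'),
      (Matrix.isUnit_iff_isUnit_det _).2 (isUnit_of_mul_isUnit_right hd'), ?_⟩
    rw [hB, mul_assoc, Matrix.mul_nonsing_inv _ hd, mul_one, he, fromBlocks_transpose]
    simp
end

section
/- Let q > 1 be a real number, and let χ₁,…,χ_m be complex numbers with |χ_i| = 1 for all i. For s real with q^{-s} sufficiently small, Σ over integer tuples λ₁ ≥ λ₂ ≥ ⋯ ≥ λ_{m-1} ≥ λ_m = 0 of s_λ(χ₁,…,χ_m) · (q^{-s})^{λ₁+⋯+λ_m} equals (1 − q^{-ms}·Π_i χ_i) / [Π_{i<j}(1 − χ_i χ_j q^{-2s}) · Π_i (1 − χ_i q^{-s})], where s_λ is the Schur polynomial det((χ_i^{λ_j + m − j})_{i,j}) / det((χ_i^{m-j})_{i,j}). -/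
open Matrix

lemma lw_prod_erase {n : ℕ} (i : Fin (n+1)) (f : Fin (n+1) → ℂ) :
    ∏ j ∈ Finset.univ.erase i, f j = ∏ j : Fin n, f (i.succAbove j) := by
  have h : (Finset.univ.erase i : Finset (Fin (n+1))) = Finset.univ.image i.succAbove := by
    ext j
    simp [Fin.exists_succAbove_eq_iff]
  rw [h, Finset.prod_image]
  intro a _ b _ hab
  exact Fin.succAbove_right_injective hab

lemma lw_lagrange (n : ℕ) (x : Fin (n+1) → ℂ) (hx : Function.Injective x)
    (h0 : ∀ i, x i ≠ 0) (h1 : ∀ i, 1 + x i ≠ 0) :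
    ∑ i, (1 - x i) * ∏ j : Fin n, (x (i.succAbove j) * (1 - x i * x (i.succAbove j)) /
      (x (i.succAbove j) - x i)) = 1 - ∏ i, x i := by
  set v : Fin (n+3) → ℂ := Fin.cons 0 (Fin.cons (-1) x) with hv
  set P : Polynomial ℂ := ∏ j, (1 - Polynomial.C (x j) * Polynomial.X) with hP
  have hinj : Function.Injective v := by
    rw [hv, Fin.cons_injective_iff, Fin.cons_injective_iff]
    refine ⟨?_, ?_, hx⟩
    · rintro ⟨i, hi⟩
      refine Fin.cases (fun hi => ?_) (fun j hi => ?_) i hi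
      · simp at hi
      · exact h0 j (by simpa using hi)
    · rintro ⟨i, hi⟩
      exact h1 i (by rw [hi]; ring)
  have hdeg : P.natDegree ≤ n + 1 := by
    refine (Polynomial.natDegree_prod_le _ _).trans ?_
    refine (Finset.sum_le_card_nsmul _ _ 1 ?_).trans (by simp)
    intro i _
    show (1 - Polynomial.C (x i) * Polynomial.X).natDegree ≤ 1
    compute_degree
  have hc := Lagrange.coeff_eq_sum (s := Finset.univ) (v := v) hinj.injOn (P := P) (by
    refine lt_of_le_of_lt Polynomial.degree_le_natDegree ?_
    simp only [Finset.card_univ, Fintype.card_fin]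
    exact_mod_cast by omega)
  rw [Polynomial.coeff_eq_zero_of_natDegree_lt (by simp; omega)] at hc
  have hev : ∀ z, P.eval z = ∏ j, (1 - x j * z) := by
    intro z; simp [hP, Polynomial.eval_prod]
  simp only [lw_prod_erase, hev] at hc
  rw [Fin.sum_univ_succ, Fin.sum_univ_succ] at hc
  have hpm : ∏ j, (1 + x j) ≠ 0 := Finset.prod_ne_zero_iff.2 fun i _ => h1 i
  have hp0 : ∏ j, x j ≠ 0 := Finset.prod_ne_zero_iff.2 fun i _ => h0 i
  have e1 : (∏ j, (1 - x j * v 0)) / ∏ j, (v 0 - v ((0 : Fin (n+3)).succAbove j))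
      = (-1)^(n+1) / ∏ j, x j := by
    rw [Fin.prod_univ_succ (fun j => v 0 - v ((0 : Fin (n+3)).succAbove j))]
    simp [hv, Finset.prod_neg]
    rcases Nat.even_or_odd (n+1) with h | h <;> simp [h.neg_one_pow, neg_div, div_neg]
  have e2 : (∏ j, (1 - x j * v (Fin.succ 0))) /
      ∏ j, (v (Fin.succ 0) - v ((Fin.succ 0 : Fin (n+3)).succAbove j)) = - (-1)^(n+1) := by
    rw [Fin.prod_univ_succ (fun j => v (Fin.succ 0) - v ((Fin.succ 0 : Fin (n+3)).succAbove j))]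
    have : ∀ j, (-1 - x j) = - (1 + x j) := fun j => by ring
    simp only [hv, Fin.succ_succAbove_zero, Fin.succ_succAbove_succ, Fin.cons_zero, Fin.cons_succ,
      Fin.succAbove_zero, this, Finset.prod_neg, mul_neg, mul_one, sub_neg_eq_add, sub_zero]
    simp only [Finset.card_univ, Fintype.card_fin]
    rcases Nat.even_or_odd (n+1) with h | h <;> simp [h.neg_one_pow, neg_div, div_neg, hpm]
  have e3 : ∀ i : Fin (n+1), (∏ j, (1 - x j * v i.succ.succ)) /
      ∏ j, (v i.succ.succ - v (i.succ.succ.succAbove j)) =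
      (-1)^n / (∏ j, x j) * ((1 - x i) * ∏ j : Fin n, (x (i.succAbove j) *
        (1 - x i * x (i.succAbove j)) / (x (i.succAbove j) - x i))) := by
    intro i
    have : ∀ j, (x i - x j) = - (x j - x i) := fun j => by ring
    rw [Fin.prod_univ_succ (fun j => v i.succ.succ - v (i.succ.succ.succAbove j)),
      Fin.prod_univ_succ (fun j : Fin (n+1) => v i.succ.succ - v (i.succ.succ.succAbove j.succ))]
    simp only [hv, Fin.succ_succAbove_zero, Fin.succ_succAbove_succ, Fin.cons_zero, Fin.cons_succ,
      sub_neg_eq_add, sub_zero]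
    rw [Fin.prod_univ_succAbove (fun j => 1 - x j * x i) i, Fin.prod_univ_succAbove x i]
    simp only [this (i.succAbove _), Finset.prod_neg, Finset.prod_div_distrib,
      Finset.prod_mul_distrib, Finset.card_univ, Fintype.card_fin]
    have hq : ∏ j, (x (i.succAbove j) - x i) ≠ 0 := Finset.prod_ne_zero_iff.2 fun j _ => by
      rw [sub_ne_zero]; exact fun h => Fin.succAbove_ne i j (hx h)
    have hr : ∏ j, x (i.succAbove j) ≠ 0 := Finset.prod_ne_zero_iff.2 fun j _ => h0 _
    have hm : ∏ j, (1 - x (i.succAbove j) * x i) = ∏ j, (1 - x i * x (i.succAbove j)) :=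
      Finset.prod_congr rfl fun j _ => by ring
    rw [hm]
    have a := h0 i
    have b := h1 i
    have b' : x i + 1 ≠ 0 := by rwa [add_comm]
    rcases Nat.even_or_odd n with h | h <;> simp only [h.neg_one_pow] <;> field_simp <;> ring
  rw [e1, e2, Finset.sum_congr rfl (fun i _ => e3 i), ← Finset.mul_sum] at hc
  field_simp at hc
  have hs : ((-1:ℂ)^n) ≠ 0 := by simp
  apply mul_left_cancel₀ hs
  rw [pow_succ] at hc
  linear_combination -hc

lemma lw_pairs {n : ℕ} (g : Fin (n+1) → Fin (n+1) → ℂ) (i : Fin (n+1)) :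
    ∏ a, ∏ b ∈ Finset.Ioi a, g a b =
     (∏ j : Fin n, if j.castSucc < i then g (i.succAbove j) i else g i (i.succAbove j)) *
      ∏ a, ∏ b ∈ Finset.Ioi a, g (i.succAbove a) (i.succAbove b) := by
  have key : ∀ (m : ℕ) (h : Fin m → Fin m → ℂ),
      ∏ a, ∏ b ∈ Finset.Ioi a, h a b = ∏ a, ∏ b, if a < b then h a b else 1 := by
    intro m h
    refine Finset.prod_congr rfl fun a _ => ?_
    rw [← Finset.prod_filter]
    refine Finset.prod_congr ?_ fun _ _ => rfl
    ext; simp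
  rw [key, key, Fin.prod_univ_succAbove _ i, Fin.prod_univ_succAbove _ i]
  simp only [Fin.prod_univ_succAbove _ i, lt_irrefl, if_false, one_mul,
    (Fin.strictMono_succAbove i).lt_iff_lt]
  rw [Finset.prod_mul_distrib, ← mul_assoc, ← Finset.prod_mul_distrib]
  congr 1
  refine Finset.prod_congr rfl fun j _ => ?_
  by_cases h : j.castSucc < i
  · have h1 : i.succAbove j < i := by rwa [Fin.succAbove_lt_iff_castSucc_lt]
    simp [h, h1, h1.not_gt]
  · have h1 : i < i.succAbove j := by
      rw [Fin.lt_succAbove_iff_le_castSucc]; exact not_lt.1 h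
    simp [h, h1, h1.not_gt]

lemma lw_sign {n : ℕ} (i : Fin (n+1)) (f : Fin n → ℂ) :
    (∏ j : Fin n, if j.castSucc < i then f j else - f j) = (-1)^((i:ℕ) + n) * ∏ j, f j := by
  have : ∀ j : Fin n, (if j.castSucc < i then f j else - f j) =
      (if j.castSucc < i then 1 else -1) * f j := by intro j; split_ifs <;> ring
  simp only [this, Finset.prod_mul_distrib]
  congr 1
  obtain ⟨d, hd⟩ := Nat.exists_eq_add_of_le (Nat.lt_succ_iff.1 i.2)
  have h1 : ∏ j : Fin n, (if j.castSucc < i then (1:ℂ) else -1) =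
      ∏ j ∈ Finset.range n, (if j < (i:ℕ) then (1:ℂ) else -1) := by
    rw [← Fin.prod_univ_eq_prod_range]
    rfl
  have h2 : ∀ (m e : ℕ), ∏ j ∈ Finset.range (m+e), (if j < m then (1:ℂ) else -1) = (-1)^e := by
    intro m e
    induction e with
    | zero =>
      refine Finset.prod_eq_one fun j hj => ?_
      rw [if_pos (by simpa using hj)]
    | succ e ih =>
      rw [← add_assoc, Finset.prod_range_succ, ih, pow_succ]
      simp
  rw [h1]
  generalize (i:ℕ) = m at *
  subst hd
  rw [h2, ← add_assoc, pow_add, ← two_mul, pow_mul]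
  simp

/-- numerator determinant -/
noncomputable def lwA (n : ℕ) (x : Fin n → ℂ) (l : Fin n → ℕ) : ℂ :=
  Matrix.det (Matrix.of fun i j : Fin n => x i ^ (l j + (n - 1 - (j : ℕ))))

noncomputable def lwD (n : ℕ) (x : Fin n → ℂ) : ℂ :=
  (∏ a, ∏ b ∈ Finset.Ioi a, (1 - x a * x b)) * ∏ i, (1 - x i)

lemma lwA_zero (n : ℕ) (x : Fin n → ℂ) :
    lwA n x 0 = ∏ a, ∏ b ∈ Finset.Ioi a, (x a - x b) := by
  have h := Matrix.det_projVandermonde (fun _ => 1) x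
  simp only [one_mul] at h
  rw [← h, lwA]
  congr 1
  ext i j
  simp only [Matrix.of_apply, Matrix.projVandermonde_apply, one_pow, one_mul, Fin.val_rev,
    Pi.zero_apply, zero_add]
  congr 1; omega

lemma lwA_add (n : ℕ) (x : Fin n → ℂ) (l : Fin n → ℕ) (c : ℕ) :
    lwA n x (fun j => l j + c) = lwA n x l * (∏ i, x i) ^ c := by
  rw [lwA, lwA, mul_comm, ← Finset.prod_pow, ← Matrix.det_mul_column]
  congr 1
  ext i j
  simp only [Matrix.of_apply, ← pow_add]
  congr 1; omega

lemma lwA_scale (n : ℕ) (x : Fin n → ℂ) (l : Fin n → ℕ) (t : ℂ) :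
    lwA n (fun i => x i * t) l = t ^ (∑ j, (l j + (n - 1 - (j : ℕ)))) * lwA n x l := by
  rw [lwA, lwA, ← Finset.prod_pow_eq_pow_sum, ← Matrix.det_mul_row]
  congr 1
  ext i j
  simp only [Matrix.of_apply, mul_pow]
  ring

lemma lwA_snoc (n : ℕ) (x : Fin (n+1) → ℂ) (l : Fin n → ℕ) :
    lwA (n+1) x (Fin.snoc l 0 : Fin (n+1) → ℕ) = ∑ i : Fin (n+1), (-1)^((i:ℕ) + n) *
      (∏ j, x (i.succAbove j)) * lwA n (fun j => x (i.succAbove j)) l := by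
  rw [lwA, Matrix.det_succ_column _ (Fin.last n)]
  refine Finset.sum_congr rfl fun i _ => ?_
  have := lwA_add n (fun j => x (i.succAbove j)) l 1
  rw [pow_one, mul_comm] at this
  rw [mul_assoc _ (∏ j, x (i.succAbove j)), ← this]
  simp only [Matrix.of_apply, Fin.snoc_last, Fin.val_last]
  have h0 : 0 + (n + 1 - 1 - n) = 0 := by omega
  rw [h0, pow_zero, mul_one, lwA]
  congr 2
  ext a b
  simp only [Matrix.submatrix_apply, Matrix.of_apply, Fin.succAbove_last, Fin.snoc_castSucc,
    Fin.val_castSucc]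
  congr 1
  have := b.2
  omega

lemma lw_D_ne (n : ℕ) (x : Fin n → ℂ) (h : ∀ i, ‖x i‖ < 1) : lwD n x ≠ 0 := by
  have h1 : ∀ z : ℂ, ‖z‖ < 1 → 1 - z ≠ 0 := by
    intro z hz h
    rw [sub_eq_zero] at h
    rw [← h] at hz
    simp at hz
  refine mul_ne_zero (Finset.prod_ne_zero_iff.2 fun a _ => Finset.prod_ne_zero_iff.2 fun b _ => ?_)
    (Finset.prod_ne_zero_iff.2 fun a _ => h1 _ (h a))
  apply h1
  rw [norm_mul]
  exact mul_lt_one_of_nonneg_of_lt_one_left (norm_nonneg _) (h a) (h b).le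

lemma lw_rec (n : ℕ) (x : Fin (n+1) → ℂ) (hx : Function.Injective x)
    (h0 : ∀ i, x i ≠ 0) (h1 : ∀ i, ‖x i‖ < 1) :
    ∑ i : Fin (n+1), (-1)^((i:ℕ) + n) * (∏ j, x (i.succAbove j)) *
      (lwA n (fun j => x (i.succAbove j)) 0 / lwD n (fun j => x (i.succAbove j))) =
    (1 - ∏ i, x i) * (lwA (n+1) x 0 / lwD (n+1) x) := by
  rw [← lw_lagrange n x hx h0, Finset.sum_mul]
  · refine Finset.sum_congr rfl fun i _ => ?_
    have hD := lw_D_ne (n+1) x h1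
    have hA : lwA (n+1) x 0 = ((-1)^((i:ℕ) + n) * ∏ j, (x (i.succAbove j) - x i)) *
        lwA n (fun j => x (i.succAbove j)) 0 := by
      rw [lwA_zero, lwA_zero, lw_pairs _ i, ← lw_sign]
      congr 1
      refine Finset.prod_congr rfl fun j _ => ?_
      split_ifs <;> ring
    have hDD : lwD (n+1) x = ((1 - x i) * ∏ j, (1 - x i * x (i.succAbove j))) *
        lwD n (fun j => x (i.succAbove j)) := by
      rw [lwD, lwD, lw_pairs _ i, Fin.prod_univ_succAbove _ i]
      have : (∏ j : Fin n, if j.castSucc < i then (1 - x (i.succAbove j) * x i)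
          else (1 - x i * x (i.succAbove j))) = ∏ j, (1 - x i * x (i.succAbove j)) := by
        refine Finset.prod_congr rfl fun j _ => ?_
        split_ifs <;> ring
      rw [this]; ring
    rw [hA]
    rw [hDD] at hD ⊢
    have hD' := hD
    simp only [mul_ne_zero_iff] at hD'
    obtain ⟨⟨d1, d2⟩, d3⟩ := hD'
    have hq : ∏ j, (x (i.succAbove j) - x i) ≠ 0 := Finset.prod_ne_zero_iff.2 fun j _ => by
      rw [sub_ne_zero]; exact fun h => Fin.succAbove_ne i j (hx h)
    simp only [Finset.prod_div_distrib, Finset.prod_mul_distrib]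
    field_simp
  · intro i h
    have := h1 i
    rw [eq_neg_of_add_eq_zero_right h] at this
    simp at this

abbrev lwL (n : ℕ) := {l : Fin n → ℕ // ∀ i j : Fin n, i ≤ j → l j ≤ l i}
abbrev lwL0 (k : ℕ) := {l : Fin (k+1) → ℕ //
            (∀ i j : Fin (k+1), i ≤ j → l j ≤ l i) ∧ l (Fin.last k) = 0}

def lwE1 (k : ℕ) : lwL k ≃ lwL0 k where
  toFun l := ⟨Fin.snoc l.1 0, by
    constructor
    · intro i j
      refine Fin.lastCases ?_ (fun j => ?_) j
      · simp
      · refine Fin.lastCases ?_ (fun i => ?_) i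
        · intro h; exact absurd h (not_le.2 (Fin.castSucc_lt_last j))
        · intro h; simpa using l.2 i j (by simpa using h)
    · simp⟩
  invFun l := ⟨fun i => l.1 i.castSucc, fun i j h => l.2.1 _ _ (by simpa using h)⟩
  left_inv l := by ext i; simp
  right_inv l := by
    ext i
    refine Fin.lastCases ?_ (fun i => ?_) i
    · simp [l.2.2]
    · simp

def lwE2 (k : ℕ) : lwL0 k × ℕ ≃ lwL (k+1) where
  toFun p := ⟨fun i => p.1.1 i + p.2, fun i j h => Nat.add_le_add_right (p.1.2.1 i j h) _⟩
  invFun l := (⟨fun i => l.1 i - l.1 (Fin.last k), fun i j h => by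
      have := l.2 i j h; dsimp only; omega, by simp⟩, l.1 (Fin.last k))
  left_inv p := by
    ext i
    · simp [p.1.2.2]
    · simp [p.1.2.2]
  right_inv l := by
    ext i
    have := l.2 i _ (Fin.le_last i)
    simp; omega

lemma lw_main0 (n : ℕ) (ih : ∀ x : Fin n → ℂ, Function.Injective x → (∀ i, x i ≠ 0) →
      (∀ i, ‖x i‖ < 1) → HasSum (fun l : lwL n => lwA n x l.1) (lwA n x 0 / lwD n x))
    (x : Fin (n+1) → ℂ) (hx : Function.Injective x)
    (h0 : ∀ i, x i ≠ 0) (h1 : ∀ i, ‖x i‖ < 1) :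
    HasSum (fun l : lwL0 n => lwA (n+1) x l.1)
      ((1 - ∏ i, x i) * (lwA (n+1) x 0 / lwD (n+1) x)) := by
  rw [← lw_rec n x hx h0 h1, ← (lwE1 n).hasSum_iff]
  have : (fun l : lwL0 n => lwA (n+1) x l.1) ∘ (lwE1 n) = fun l : lwL n =>
      ∑ i : Fin (n+1), (-1)^((i:ℕ) + n) *
      (∏ j, x (i.succAbove j)) * lwA n (fun j => x (i.succAbove j)) l.1 := by
    funext l
    exact lwA_snoc n x l.1
  rw [this]
  refine hasSum_sum fun i _ => HasSum.mul_left _ ?_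
  exact ih _ (fun a b h => Fin.succAbove_right_injective (hx h)) (fun _ => h0 _) (fun _ => h1 _)

lemma lw_main (n : ℕ) : ∀ x : Fin n → ℂ, Function.Injective x → (∀ i, x i ≠ 0) →
      (∀ i, ‖x i‖ < 1) → HasSum (fun l : lwL n => lwA n x l.1) (lwA n x 0 / lwD n x) := by
  induction n with
  | zero =>
    intro x _ _ _
    haveI : Unique (lwL 0) := ⟨⟨⟨0, fun i => i.elim0⟩⟩, fun a => Subtype.ext (Subsingleton.elim _ _)⟩
    have := hasSum_unique (fun l : lwL 0 => lwA 0 x l.1)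
    simpa [lwA, lwD] using this
  | succ n ih =>
    intro x hx h0 h1
    have hm := lw_main0 n ih x hx h0 h1
    have hp : ‖∏ i, x i‖ < 1 := by
      rw [norm_prod, Fin.prod_univ_succ]
      refine mul_lt_one_of_nonneg_of_lt_one_left (norm_nonneg _) (h1 0) ?_
      exact Finset.prod_le_one (fun _ _ => norm_nonneg _) fun i _ => (h1 _).le
    have hg := hasSum_geometric_of_norm_lt_one hp
    have hs1 : Summable fun l : lwL0 n => ‖lwA (n+1) x l.1‖ := hm.summable.norm
    have hs2 : Summable fun c : ℕ => ‖(∏ i, x i) ^ c‖ := hg.summable.norm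
    have hs := summable_mul_of_summable_norm (f := fun l : lwL0 n => lwA (n+1) x l.1)
      (g := fun c : ℕ => (∏ i, x i) ^ c) hs1 hs2
    have hmul := HasSum.mul hm hg hs
    rw [← (lwE2 n).hasSum_iff]
    have hne : 1 - ∏ i, x i ≠ 0 := by
      intro h
      rw [sub_eq_zero] at h
      rw [← h] at hp
      simp at hp
    have e1 : (fun l : lwL (n+1) => lwA (n+1) x l.1) ∘ (lwE2 n) = fun p : lwL0 n × ℕ =>
        lwA (n+1) x p.1.1 * (∏ i, x i) ^ p.2 := by
      funext p
      exact lwA_add (n+1) x p.1.1 p.2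
    have e2 : lwA (n+1) x 0 / lwD (n+1) x =
        (1 - ∏ i, x i) * (lwA (n+1) x 0 / lwD (n+1) x) * (1 - ∏ i, x i)⁻¹ := by
      rw [mul_comm (1 - ∏ i, x i), mul_assoc, mul_inv_cancel₀ hne, mul_one]
    rw [e1, e2]
    exact hmul

theorem stmt_13 (k : ℕ) (χ : Fin (k+1) → ℂ)
    (hu : ∀ i, ‖χ i‖ = 1) (hinj : Function.Injective χ) :
    ∃ ε > (0 : ℝ), ∀ t : ℂ, ‖t‖ < ε →
      HasSum
        (fun lam : {l : Fin (k+1) → ℕ //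
            (∀ i j : Fin (k+1), i ≤ j → l j ≤ l i) ∧ l (Fin.last k) = 0} =>
          (Matrix.det (Matrix.of fun i j : Fin (k+1) => χ i ^ (lam.1 j + (k - (j : ℕ)))) /
            Matrix.det (Matrix.of fun i j : Fin (k+1) => χ i ^ (k - (j : ℕ))))
            * t ^ (∑ i, lam.1 i))
        ((1 - t ^ (k+1) * ∏ i, χ i) /
          ((∏ pr ∈ Finset.univ.filter (fun pr : Fin (k+1) × Fin (k+1) => pr.1 < pr.2),
              (1 - χ pr.1 * χ pr.2 * t ^ 2)) * ∏ i, (1 - χ i * t))) := by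
  refine ⟨1, one_pos, fun t ht => ?_⟩
  have hA0 : Matrix.det (Matrix.of fun i j : Fin (k+1) => χ i ^ (k - (j : ℕ))) =
      lwA (k+1) χ 0 := by
    simp [lwA]
  have hA : ∀ l : Fin (k+1) → ℕ,
      Matrix.det (Matrix.of fun i j : Fin (k+1) => χ i ^ (l j + (k - (j : ℕ)))) =
      lwA (k+1) χ l := fun l => rfl
  simp only [hA0, hA]
  have hne : lwA (k+1) χ 0 ≠ 0 := by
    rw [lwA_zero]
    refine Finset.prod_ne_zero_iff.2 fun a _ => Finset.prod_ne_zero_iff.2 fun b hb => ?_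
    rw [sub_ne_zero]
    exact fun h => (Finset.mem_Ioi.1 hb).ne (hinj h)
  by_cases h0 : t = 0
  · subst h0
    have : HasSum (fun lam : lwL0 k => lwA (k+1) χ lam.1 / lwA (k+1) χ 0 * 0 ^ (∑ i, lam.1 i))
        (lwA (k+1) χ 0 / lwA (k+1) χ 0 * 0 ^ (∑ i : Fin (k+1), (0 : Fin (k+1) → ℕ) i)) := by
      refine hasSum_single (⟨0, by simp⟩ : lwL0 k) ?_
      intro l hl
      rw [zero_pow, mul_zero]
      intro h
      apply hl
      ext i
      simpa using (Finset.sum_eq_zero_iff.1 h) i (Finset.mem_univ _)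
    simpa [hne] using this
  · have hm := lw_main0 k (lw_main k) (fun i => χ i * t)
      (fun a b h => hinj (mul_right_cancel₀ h0 h))
      (fun i => mul_ne_zero (by intro h; have := hu i; simp [h] at this) h0)
      (fun i => by simpa [hu i] using ht)
    have hm2 := hm.div_const (lwA (k+1) (fun i => χ i * t) 0)
    have hts : ∀ m : ℕ, t ^ m ≠ 0 := fun m => pow_ne_zero m h0
    have hne2 : lwA (k+1) (fun i => χ i * t) 0 ≠ 0 := by
      rw [lwA_scale]; exact mul_ne_zero (hts _) hne
    have f1 : (fun l : lwL0 k => lwA (k+1) χ l.1 / lwA (k+1) χ 0 * t ^ (∑ i, l.1 i)) =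
        fun l : lwL0 k => lwA (k+1) (fun i => χ i * t) l.1 / lwA (k+1) (fun i => χ i * t) 0 := by
      funext l
      rw [lwA_scale, lwA_scale, Finset.sum_add_distrib, Finset.sum_add_distrib, pow_add, pow_add]
      have := hts (∑ j : Fin (k+1), (k + 1 - 1 - (j:ℕ)))
      simp only [Pi.zero_apply, Finset.sum_const_zero, pow_zero]
      field_simp
    · refine (congrArg₂ HasSum f1 ?_).mpr hm2
      rw [lwD]
      have e1 : ∏ i, (χ i * t) = t ^ (k+1) * ∏ i, χ i := by
        rw [Finset.prod_mul_distrib]; simp [mul_comm]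
      have e2 : (∏ pr ∈ Finset.univ.filter (fun pr : Fin (k+1) × Fin (k+1) => pr.1 < pr.2),
              (1 - χ pr.1 * χ pr.2 * t ^ 2)) =
          ∏ a, ∏ b ∈ Finset.Ioi a, (1 - χ a * t * (χ b * t)) := by
        rw [Finset.prod_filter, Fintype.prod_prod_type]
        refine Finset.prod_congr rfl fun a _ => ?_
        rw [← Finset.prod_filter]
        refine Finset.prod_congr (by ext; simp) fun b _ => by ring
      rw [e1, e2, mul_div_assoc, div_right_comm, div_self hne2, mul_one_div]
end
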